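/- arXiv:2012.15795 — 3 statements merged into one kernel-verified Lean document; each statement's English description precedes it below -/
import Mathlib

section
/- Let n ≥ 1 and κ > 0, and let B'^n = A^{2n}/⟨Flip⟩. For every 1 ≤ i ≤ 2n and every π : B'^n → R>0, one has h^B_i(π) · h^B_i(Rvac^B_A(π)) = κ²; that is, each h^B_i is multiplicatively κ-mesic with respect to birational antichain rowvacuation of B'^n. -/
open scoped Classical

noncomputable section

/-- `P̂`: the poset `P` with a new minimum `0̂` and a new maximum `1̂` adjoined. -/
abbrev Phat (P : Type) := WithBot (WithTop P)

instance {P : Type} [Fintype P] : Fintype (Phat P) :=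
  inferInstanceAs (Fintype (Option (Option P)))

/-- The inclusion of `P` into `P̂`. -/
def emb {P : Type} (p : P) : Phat P := ((p : WithTop P) : WithBot (WithTop P))

/-- The new maximum `1̂` of `P̂`. -/
def topHat (P : Type) : Phat P := ((⊤ : WithTop P) : WithBot (WithTop P))

variable {P : Type} [Fintype P] [PartialOrder P]

/-- `∑_{y ⋖ x} π(y)`. -/
def covSumBelow (π : Phat P → ℝ) (x : Phat P) : ℝ :=
  ∑ y : Phat P, if y ⋖ x then π y else 0

/-- `∑_{x ⋖ y} 1/π(y)`. -/
def covSumAboveInv (π : Phat P → ℝ) (x : Phat P) : ℝ :=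
  ∑ y : Phat P, if x ⋖ y then (π y)⁻¹ else 0

/-- The birational order-filter rank toggle `𝐭_i`, in simultaneous form (it agrees with the
composition of the pairwise commuting birational order filter toggles `t_p` over `p ∈ P_i`,
since a toggle `t_p` only changes the value at `p` and only reads values at `p` and at
elements covering or covered by `p`, which have different ranks). -/
def rankToggleB (rk : P → ℕ) (i : ℕ) (π : Phat P → ℝ) : Phat P → ℝ :=
  fun x =>
    if ∃ p : P, rk p = i ∧ x = emb p then
      covSumBelow π x / (π x * covSumAboveInv π x)
    else π x

/-- Apply a word of rank toggles; the head of the list is applied last, matching the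
convention that in a product `𝐭_{i_1} 𝐭_{i_2} ⋯ 𝐭_{i_k}` the rightmost factor acts first. -/
def applyB (rk : P → ℕ) : List ℕ → (Phat P → ℝ) → Phat P → ℝ
  | [] => fun π => π
  | i :: w => fun π => rankToggleB rk i (applyB rk w π)

/-- The word `𝐭_0 𝐭_1 ⋯ 𝐭_r` for rowmotion. -/
def rowWordB (r : ℕ) : List ℕ := List.range (r + 1)

/-- The word `(𝐭_r)(𝐭_{r-1} 𝐭_r) ⋯ (𝐭_0 𝐭_1 ⋯ 𝐭_r)` for rowvacuation. -/
def rvacWordB (r : ℕ) : List ℕ :=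
  (List.range (r + 1)).foldr (fun k acc => (List.range (r + 1)).drop (r - k) ++ acc) []

/-- The word `(𝐭_0)(𝐭_1 𝐭_0) ⋯ (𝐭_r 𝐭_{r-1} ⋯ 𝐭_0)` for dual rowvacuation. -/
def drvacWordB (r : ℕ) : List ℕ :=
  (List.range (r + 1)).foldr (fun k acc => (List.range (k + 1)).reverse ++ acc) []

/-- Birational order filter rowmotion `Row^B_F = 𝐭_0 𝐭_1 ⋯ 𝐭_r`. -/
def RowB (rk : P → ℕ) (r : ℕ) : (Phat P → ℝ) → Phat P → ℝ := applyB rk (rowWordB r)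

/-- The inverse of birational order filter rowmotion, `(Row^B_F)⁻¹ = 𝐭_r ⋯ 𝐭_1 𝐭_0`
(each toggle is an involution, so the reversed word gives the inverse map). -/
def RowInvB (rk : P → ℕ) (r : ℕ) : (Phat P → ℝ) → Phat P → ℝ := applyB rk (rowWordB r).reverse

/-- Birational order filter rowvacuation `Rvac^B_F`. -/
def RvacB (rk : P → ℕ) (r : ℕ) : (Phat P → ℝ) → Phat P → ℝ := applyB rk (rvacWordB r)

/-- Birational order filter dual rowvacuation `DRvac^B_F`. -/
def DRvacB (rk : P → ℕ) (r : ℕ) : (Phat P → ℝ) → Phat P → ℝ := applyB rk (drvacWordB r)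

end

noncomputable section

variable {P : Type} [Fintype P] [PartialOrder P]

/-- The sum, over all maximal chains `C` of `P` containing `p`, of `∏_{y ∈ C} π(y)`. -/
def chainSum (π : P → ℝ) (p : P) : ℝ :=
  ∑ C ∈ Finset.univ.filter
      (fun C : Finset P => IsMaxChain (· ≤ ·) (C : Set P) ∧ p ∈ C),
    ∏ y ∈ C, π y

/-- The birational antichain rank toggle `𝛕_i`, in simultaneous form (it agrees with the
composition of the pairwise commuting birational antichain toggles `τ_p` over `p ∈ P_i`,
since in a graded poset no maximal chain contains two distinct elements of the same rank). -/
def arankToggleB (κ : ℝ) (rk : P → ℕ) (i : ℕ) (π : P → ℝ) : P → ℝ :=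
  fun x => if rk x = i then κ / chainSum π x else π x

/-- Apply a word of antichain rank toggles; the head of the list is applied last. -/
def aApplyB (κ : ℝ) (rk : P → ℕ) : List ℕ → (P → ℝ) → P → ℝ
  | [] => fun π => π
  | i :: w => fun π => arankToggleB κ rk i (aApplyB κ rk w π)

/-- The word `𝛕_r 𝛕_{r-1} ⋯ 𝛕_0` for antichain rowmotion. -/
def arowWordB (r : ℕ) : List ℕ := (List.range (r + 1)).reverse

/-- The word `(𝛕_r)(𝛕_r 𝛕_{r-1}) ⋯ (𝛕_r 𝛕_{r-1} ⋯ 𝛕_1 𝛕_0)` for antichain rowvacuation. -/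
def arvacWordB (r : ℕ) : List ℕ :=
  (List.range (r + 1)).foldr
    (fun k acc => (List.range (r + 1)).reverse.take (k + 1) ++ acc) []

/-- Birational antichain rowmotion `Row^B_A = 𝛕_r 𝛕_{r-1} ⋯ 𝛕_0`. -/
def RowAB (κ : ℝ) (rk : P → ℕ) (r : ℕ) : (P → ℝ) → P → ℝ := aApplyB κ rk (arowWordB r)

/-- Birational antichain rowvacuation `Rvac^B_A`. -/
def RvacAB (κ : ℝ) (rk : P → ℕ) (r : ℕ) : (P → ℝ) → P → ℝ := aApplyB κ rk (arvacWordB r)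

end

noncomputable section

/-- Membership predicate for the quotient poset `B'ⁿ = A^{2n}/⟨Flip⟩`, where
`Flip([i,j]) = [2n+1-j, 2n+1-i]` is the reflection of `A^{2n}`: each orbit
`{p, Flip p}` is recorded by its unique representative `[i,j]` with `i + j ≤ 2n+1`. -/
def BPmem (n : ℕ) (p : ℕ × ℕ) : Prop :=
  1 ≤ p.1 ∧ p.1 ≤ p.2 ∧ p.2 ≤ 2 * n ∧ p.1 + p.2 ≤ 2 * n + 1

/-- The quotient poset `B'ⁿ = A^{2n}/⟨Flip⟩`, realized on orbit representatives. -/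
def BP (n : ℕ) : Type := {p : ℕ × ℕ // BPmem n p}

/-- The order relation of `B'ⁿ` on representatives: `⟨Flip⟩p ≤ ⟨Flip⟩q` iff `p ≤ q` or
`p ≤ Flip q` in `A^{2n}` (this relation is reflexive, transitive and antisymmetric, and
it is the partial order generated by declaring `⟨Flip⟩p ≤ ⟨Flip⟩q` whenever `p ≤ q`). -/
def BPle (n : ℕ) (x y : ℕ × ℕ) : Prop :=
  (y.1 ≤ x.1 ∧ x.2 ≤ y.2) ∨ (2 * n + 1 - y.2 ≤ x.1 ∧ x.2 ≤ 2 * n + 1 - y.1)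

instance (n : ℕ) : PartialOrder (BP n) where
  le x y := BPle n x.val y.val
  le_refl x := Or.inl ⟨le_refl _, le_refl _⟩
  le_trans x y z h1 h2 := by
    have hx := x.2
    have hy := y.2
    have hz := z.2
    simp only [BPmem] at hx hy hz
    simp only [BPle] at h1 h2 ⊢
    omega
  le_antisymm x y h1 h2 := by
    have hx := x.2
    have hy := y.2
    simp only [BPmem] at hx hy
    simp only [BPle] at h1 h2
    apply Subtype.ext
    apply Prod.ext_iff.mpr
    omega

instance (n : ℕ) : Fintype (BP n) :=
  Fintype.subtype
    ((Finset.Icc 1 (2 * n) ×ˢ Finset.Icc 1 (2 * n)).filter (BPmem n))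
    (by
      intro x
      simp only [Finset.mem_filter, Finset.mem_product, Finset.mem_Icc, BPmem]
      omega)

/-- The rank function of `B'ⁿ` (induced from `A^{2n}`): `rk ⟨Flip⟩[i,j] = j - i`;
`B'ⁿ` is graded of rank `2n - 1`. -/
def rkBP (n : ℕ) : BP n → ℕ := fun p => p.val.2 - p.val.1

/-- The orbit `⟨Flip⟩p` of an element `p` of `A^{2n}`, as an element of `B'ⁿ`. -/
def toBP (n : ℕ) (p : ℕ × ℕ) (h : 1 ≤ p.1 ∧ p.1 ≤ p.2 ∧ p.2 ≤ 2 * n) : BP n :=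
  if h2 : p.1 + p.2 ≤ 2 * n + 1 then ⟨p, ⟨h.1, h.2.1, h.2.2, h2⟩⟩
  else ⟨(2 * n + 1 - p.2, 2 * n + 1 - p.1), by
    unfold BPmem
    show 1 ≤ 2 * n + 1 - p.2 ∧ 2 * n + 1 - p.2 ≤ 2 * n + 1 - p.1 ∧
      2 * n + 1 - p.1 ≤ 2 * n ∧ (2 * n + 1 - p.2) + (2 * n + 1 - p.1) ≤ 2 * n + 1
    omega⟩

/-- The statistic `h^B_i(π) = ∏_{j=i}^{2n} π(⟨Flip⟩[i,j]) · ∏_{j=1}^{i} π(⟨Flip⟩[j,i])`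
on `A^B_κ(B'ⁿ)`. -/
def hBB (n i : ℕ) (π : BP n → ℝ) : ℝ :=
  (∏ j ∈ Finset.Icc i (2 * n),
    if h : 1 ≤ i ∧ i ≤ j ∧ j ≤ 2 * n then π (toBP n (i, j) h) else 1) *
  (∏ j ∈ Finset.Icc 1 i,
    if h : 1 ≤ j ∧ j ≤ i ∧ i ≤ 2 * n then π (toBP n (j, i) h) else 1)

end

section MaximalChains

variable {P : Type} [Fintype P] [PartialOrder P]

/-- The maximal chains of the ray `{y | r x y}`, for `r` one of `≤` and `≥`. -/
noncomputable def rayChains (r : P → P → Prop) (x : P) : Finset (Finset P) :=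
  Finset.univ.filter fun C : Finset P =>
    IsChain r (C : Set P) ∧ x ∈ C ∧ (∀ y ∈ C, r x y) ∧
      ∀ z, r x z → (∀ y ∈ C, r z y ∨ r y z) → z ∈ C

/-- The weighted count of the maximal chains of `{y | x ≤ y}`. -/
noncomputable def upSum (π : P → ℝ) (x : P) : ℝ :=
  ∑ C ∈ rayChains (· ≤ ·) x, ∏ y ∈ C, π y

/-- The weighted count of the maximal chains of `{y | y ≤ x}`. -/
noncomputable def downSum (π : P → ℝ) (x : P) : ℝ :=
  ∑ C ∈ rayChains (· ≥ ·) x, ∏ y ∈ C, π y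

/-- The weighted count of the maximal chains of `{y | y ≤ x}`, not counting the weight of `x`. -/
noncomputable def downSumErase (π : P → ℝ) (x : P) : ℝ :=
  ∑ C ∈ rayChains (· ≥ ·) x, ∏ y ∈ C.erase x, π y

theorem mem_rayChains {Q : Type} [Fintype Q] {r : Q → Q → Prop} {x : Q} {C : Finset Q} :
    C ∈ rayChains r x ↔ IsChain r (C : Set Q) ∧ x ∈ C ∧ (∀ y ∈ C, r x y) ∧
      ∀ z, r x z → (∀ y ∈ C, r z y ∨ r y z) → z ∈ C := by
  simp [rayChains]

theorem downSum_eq_mul (π : P → ℝ) (x : P) : downSum π x = π x * downSumErase π x := by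
  unfold downSum downSumErase
  rw [Finset.mul_sum]
  refine Finset.sum_congr rfl fun C hC => ?_
  exact (Finset.mul_prod_erase C π (mem_rayChains.1 hC).2.1).symm

theorem isMaxChain_iff {Q : Type} [PartialOrder Q] {C : Finset Q} :
    IsMaxChain (· ≤ ·) (C : Set Q) ↔ IsChain (· ≤ ·) (C : Set Q) ∧
      ∀ z, (∀ y ∈ C, z ≤ y ∨ y ≤ z) → z ∈ C := by
  constructor
  · rintro ⟨h1, h2⟩
    refine ⟨h1, fun z hz => ?_⟩
    have h3 := h2 (h1.insert (a := z) fun b hb _ => hz b hb) (Set.subset_insert _ _)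
    have h4 : z ∈ (C : Set Q) := h3 ▸ Set.mem_insert _ _
    exact h4
  · rintro ⟨h1, h2⟩
    refine ⟨h1, fun t ht hCt => Set.Subset.antisymm hCt fun z hz => h2 z fun y hy => ?_⟩
    exact ht.total hz (hCt hy)

theorem chainSum_eq (π : P → ℝ) (p : P) :
    chainSum π p = upSum π p * downSumErase π p := by
  unfold chainSum upSum downSumErase
  rw [Finset.sum_mul_sum, ← Finset.sum_product']
  refine Finset.sum_bij'
    (fun C _ => (C.filter (p ≤ ·), C.filter (· ≤ p))) (fun A _ => A.1 ∪ A.2) ?_ ?_ ?_ ?_ ?_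
  · intro C hC
    simp only [Finset.mem_filter, Finset.mem_univ, true_and, isMaxChain_iff] at hC
    obtain ⟨⟨hc, hm⟩, hp⟩ := hC
    simp only [Finset.mem_product, mem_rayChains, Finset.mem_filter]
    refine ⟨⟨hc.mono (by intro; simp +contextual), ⟨hp, le_rfl⟩, fun y hy => hy.2, ?_⟩,
      ⟨(hc.mono (by intro; simp +contextual)).symm, ⟨hp, le_rfl⟩, fun y hy => hy.2, ?_⟩⟩
    · intro z hz h
      refine ⟨hm z fun y hy => ?_, hz⟩
      rcases hc.total hp hy with h1 | h1
      · exact h y ⟨hy, h1⟩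
      · exact Or.inr (h1.trans hz)
    · intro z hz h
      refine ⟨hm z fun y hy => ?_, hz⟩
      rcases hc.total hp hy with h1 | h1
      · exact Or.inl (le_trans hz h1)
      · exact (h y ⟨hy, h1⟩).symm
  · rintro ⟨A, B⟩ h
    simp only [Finset.mem_product, mem_rayChains] at h
    obtain ⟨⟨hA, hpA, hA', hAm⟩, ⟨hB, hpB, hB', hBm⟩⟩ := h
    simp only [Finset.mem_filter, Finset.mem_univ, true_and, isMaxChain_iff, Finset.mem_union]
    refine ⟨⟨?_, ?_⟩, Or.inl hpA⟩
    · rintro x hx y hy hxy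
      simp only [Finset.coe_union, Set.mem_union, Finset.mem_coe] at hx hy
      rcases hx with hx | hx <;> rcases hy with hy | hy
      · exact hA hx hy hxy
      · exact Or.inr (le_trans (hB' y hy) (hA' x hx))
      · exact Or.inl (le_trans (hB' x hx) (hA' y hy))
      · exact (hB hx hy hxy).symm
    · intro z hz
      rcases hz p (Or.inl hpA) with h1 | h1
      · exact Or.inr (hBm z h1 fun y hy => (hz y (Or.inr hy)).symm)
      · exact Or.inl (hAm z h1 fun y hy => hz y (Or.inl hy))
  · intro C hC
    simp only [Finset.mem_filter, Finset.mem_univ, true_and, isMaxChain_iff] at hC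
    ext y
    simp only [Finset.mem_union, Finset.mem_filter]
    constructor
    · tauto
    · intro hy
      rcases hC.1.1.total hC.2 hy with h1 | h1
      · exact Or.inl ⟨hy, h1⟩
      · exact Or.inr ⟨hy, h1⟩
  · rintro ⟨A, B⟩ h
    simp only [Finset.mem_product, mem_rayChains] at h
    obtain ⟨⟨hA, hpA, hA', hAm⟩, ⟨hB, hpB, hB', hBm⟩⟩ := h
    ext y
    · simp only [Finset.mem_union, Finset.mem_filter]
      constructor
      · rintro ⟨h1 | h1, h2⟩
        · exact h1
        · rwa [le_antisymm (hB' y h1) h2]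
      · exact fun h => ⟨Or.inl h, hA' y h⟩
    · simp only [Finset.mem_union, Finset.mem_filter]
      constructor
      · rintro ⟨h1 | h1, h2⟩
        · rwa [le_antisymm h2 (hA' y h1)]
        · exact h1
      · exact fun h => ⟨Or.inr h, hB' y h⟩
  · intro C hC
    simp only [Finset.mem_filter, Finset.mem_univ, true_and, isMaxChain_iff] at hC
    rw [← Finset.prod_filter_mul_prod_filter_not C (p ≤ ·)]
    congr 1
    refine Finset.prod_congr ?_ fun _ _ => rfl
    ext y
    simp only [Finset.mem_filter, Finset.mem_erase]
    constructor
    · rintro ⟨h1, h2⟩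
      refine ⟨fun h => h2 h.ge, h1, (hC.1.1.total hC.2 h1).resolve_left h2⟩
    · rintro ⟨h1, h2, h3⟩
      exact ⟨h2, fun h => h1 (le_antisymm h3 h)⟩

theorem upSum_of_isMax (π : P → ℝ) {x : P} (hx : IsMax x) : upSum π x = π x := by
  have h : rayChains (· ≤ ·) x = {{x}} := by
    ext C
    rw [mem_rayChains, Finset.mem_singleton]
    constructor
    · rintro ⟨-, h1, h2, -⟩
      ext y
      rw [Finset.mem_singleton]
      exact ⟨fun hy => (hx.eq_of_le (h2 y hy)).symm, fun h => h ▸ h1⟩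
    · rintro rfl
      refine ⟨by simp, by simp, by simp, fun z hz _ => ?_⟩
      rw [Finset.mem_singleton, hx.eq_of_le hz]
  simp [upSum, h]

theorem upSum_of_not_isMax (π : P → ℝ) {x : P} (hx : ¬ IsMax x) :
    upSum π x = π x * ∑ z ∈ Finset.univ.filter (x ⋖ ·), upSum π z := by
  unfold upSum
  rw [Finset.mul_sum]
  simp_rw [Finset.mul_sum]
  rw [Finset.sum_sigma']
  symm
  have hnot : ∀ z : P, x ⋖ z → ∀ C ∈ rayChains (· ≤ ·) z, x ∉ C := fun z hz C hC hxC =>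
    (hz.lt.trans_le ((mem_rayChains.1 hC).2.2.1 x hxC)).false
  refine Finset.sum_bij (fun A _ => insert x A.2) ?_ ?_ ?_ ?_
  · rintro ⟨z, C⟩ h
    simp only [Finset.mem_sigma, Finset.mem_filter, Finset.mem_univ, true_and, mem_rayChains] at h
    obtain ⟨hz, hc, hzC, hC, hm⟩ := h
    rw [mem_rayChains]
    refine ⟨?_, Finset.mem_insert_self _ _, ?_, ?_⟩
    · rw [Finset.coe_insert]
      exact hc.insert fun b hb _ => Or.inl (hz.le.trans (hC b hb))
    · intro y hy
      rcases Finset.mem_insert.1 hy with rfl | hy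
      · exact le_rfl
      · exact hz.le.trans (hC y hy)
    · intro w hw h
      rcases hw.eq_or_lt with rfl | hw
      · exact Finset.mem_insert_self _ _
      refine Finset.mem_insert_of_mem (hm w ?_ fun y hy => h y (Finset.mem_insert_of_mem hy))
      rcases h z (Finset.mem_insert_of_mem hzC) with h1 | h1
      · exact (h1.eq_or_lt.resolve_right (hz.2 hw)).ge
      · exact h1
  · rintro ⟨z, C⟩ h ⟨z', C'⟩ h' heq
    simp only [Finset.mem_sigma, Finset.mem_filter, Finset.mem_univ, true_and] at h h'
    have hCC : C = C' := by
      rw [← Finset.erase_insert (hnot z h.1 C h.2), heq, Finset.erase_insert (hnot z' h'.1 C' h'.2)]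
    subst hCC
    have h1 := mem_rayChains.1 h.2
    have h2 := mem_rayChains.1 h'.2
    have : z = z' := le_antisymm (h1.2.2.1 _ h2.2.1) (h2.2.2.1 _ h1.2.1)
    subst this
    rfl
  · intro C hC
    obtain ⟨hc, hxC, hC', hm⟩ := mem_rayChains.1 hC
    have hne : (C.erase x).Nonempty := by
      by_contra hempty
      rw [Finset.not_nonempty_iff_eq_empty] at hempty
      obtain ⟨w, hw⟩ := not_isMax_iff.1 hx
      have : w ∈ C := hm w hw.le fun y hy => by
        have : y = x := by
          by_contra hyx
          have : y ∈ C.erase x := Finset.mem_erase.2 ⟨hyx, hy⟩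
          simp [hempty] at this
        exact Or.inr (this ▸ hw.le)
      have : w ∈ C.erase x := Finset.mem_erase.2 ⟨hw.ne', this⟩
      simp [hempty] at this
    obtain ⟨z, hz, hzmin⟩ := (C.erase x).exists_minimal hne
    have hzx := (Finset.mem_erase.1 hz).1
    have hzC := (Finset.mem_erase.1 hz).2
    have hlt : x < z := lt_of_le_of_ne (hC' z hzC) (Ne.symm hzx)
    have hle : ∀ y ∈ C.erase x, z ≤ y := fun y hy => by
      rcases hc.total hzC (Finset.mem_erase.1 hy).2 with h | h
      · exact h
      · exact hzmin hy h
    have hcov : x ⋖ z := by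
      refine ⟨hlt, fun w hw hwz => ?_⟩
      have : w ∈ C := hm w hw.le fun y hy => by
        by_cases hyx : y = x
        · exact Or.inr (hyx ▸ hw.le)
        · exact Or.inl (hwz.le.trans (hle y (Finset.mem_erase.2 ⟨hyx, hy⟩)))
      exact (hwz.trans_le (hle w (Finset.mem_erase.2 ⟨hw.ne', this⟩))).false
    refine ⟨⟨z, C.erase x⟩, ?_, Finset.insert_erase hxC⟩
    simp only [Finset.mem_sigma, Finset.mem_filter, Finset.mem_univ, true_and, mem_rayChains]
    refine ⟨hcov, hc.mono (by simp), hz, hle, fun w hw h => Finset.mem_erase.2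
      ⟨(hlt.trans_le hw).ne', hm w (hlt.le.trans hw) fun y hy => ?_⟩⟩
    by_cases hyx : y = x
    · exact Or.inr (hyx ▸ hlt.le.trans hw)
    · exact h y (Finset.mem_erase.2 ⟨hyx, hy⟩)
  · rintro ⟨z, C⟩ h
    simp only [Finset.mem_sigma, Finset.mem_filter, Finset.mem_univ, true_and] at h
    exact (Finset.prod_insert (hnot z h.1 C h.2)).symm

theorem downSum_eq_upSum_dual (π : P → ℝ) (x : P) :
    downSum π x = upSum (P := Pᵒᵈ) (fun y => π (OrderDual.ofDual y)) (OrderDual.toDual x) := rfl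

theorem downSum_of_isMin (π : P → ℝ) {x : P} (hx : IsMin x) : downSum π x = π x := by
  rw [downSum_eq_upSum_dual, upSum_of_isMax _ hx.toDual]
  rfl

theorem downSum_of_not_isMin (π : P → ℝ) {x : P} (hx : ¬ IsMin x) :
    downSum π x = π x * ∑ y ∈ Finset.univ.filter (· ⋖ x), downSum π y := by
  rw [downSum_eq_upSum_dual, upSum_of_not_isMax]
  · congr 1
    refine Finset.sum_bij (fun y _ => OrderDual.ofDual y) ?_ ?_ ?_ ?_
    · intro y hy
      simp only [Finset.mem_filter, Finset.mem_univ, true_and] at hy ⊢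
      exact hy.ofDual
    · intro _ _ _ _ h
      exact h
    · intro y hy
      simp only [Finset.mem_filter, Finset.mem_univ, true_and] at hy
      exact ⟨OrderDual.toDual y, by simpa using hy, rfl⟩
    · intro _ _
      rfl
  · exact fun h => hx (isMax_toDual_iff.1 h)

theorem upSum_pos {π : P → ℝ} (hπ : ∀ y, 0 < π y) (x : P) : 0 < upSum π x := by
  induction x using (wellFounded_gt (α := P)).induction with
  | _ x ih =>
    by_cases hx : IsMax x
    · rw [upSum_of_isMax π hx]
      exact hπ x
    · rw [upSum_of_not_isMax π hx]
      obtain ⟨z, hz⟩ := exists_covBy_of_wellFoundedLT hx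
      refine mul_pos (hπ x) (Finset.sum_pos (fun z hz => ?_) ⟨z, by simpa using hz⟩)
      exact ih z (Finset.mem_filter.1 hz).2.lt

theorem downSum_pos {π : P → ℝ} (hπ : ∀ y, 0 < π y) (x : P) : 0 < downSum π x := by
  rw [downSum_eq_upSum_dual]
  exact upSum_pos (fun y => hπ _) _

theorem downSumErase_pos {π : P → ℝ} (hπ : ∀ y, 0 < π y) (x : P) : 0 < downSumErase π x :=
  (mul_pos_iff_of_pos_left (hπ x)).1 (downSum_eq_mul π x ▸ downSum_pos hπ x)

theorem downSumErase_of_isMin {π : P → ℝ} (hπ : ∀ y, 0 < π y) {x : P} (hx : IsMin x) :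
    downSumErase π x = 1 := by
  have h := downSum_of_isMin π hx
  rw [downSum_eq_mul] at h
  exact mul_left_cancel₀ (hπ x).ne' (h.trans (mul_one _).symm)

theorem downSumErase_of_not_isMin {π : P → ℝ} (hπ : ∀ y, 0 < π y) {x : P} (hx : ¬ IsMin x) :
    downSumErase π x = ∑ y ∈ Finset.univ.filter (· ⋖ x), downSum π y := by
  have h := downSum_of_not_isMin π hx
  rw [downSum_eq_mul] at h
  exact mul_left_cancel₀ (hπ x).ne' h

theorem upSum_congr {π π' : P → ℝ} {x : P} (h : ∀ y, x ≤ y → π y = π' y) :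
    upSum π x = upSum π' x :=
  Finset.sum_congr rfl fun _ hC =>
    Finset.prod_congr rfl fun y hy => h y ((mem_rayChains.1 hC).2.2.1 y hy)

theorem downSumErase_congr {π π' : P → ℝ} {x : P} (h : ∀ y, y < x → π y = π' y) :
    downSumErase π x = downSumErase π' x :=
  Finset.sum_congr rfl fun _ hC => Finset.prod_congr rfl fun y hy =>
    h y (lt_of_le_of_ne ((mem_rayChains.1 hC).2.2.1 y (Finset.mem_erase.1 hy).2)
      (Finset.mem_erase.1 hy).1)

end MaximalChains

section Rowvacuation

variable {P : Type} [Fintype P] [PartialOrder P]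

/-- The word `(m + l - 1) ⋯ (m + 1) m`. -/
def descWord (m : ℕ) : ℕ → List ℕ
  | 0 => []
  | l + 1 => (m + l) :: descWord m l

theorem take_reverse_range (r k : ℕ) (hk : k ≤ r) :
    (List.range (r + 1)).reverse.take (k + 1) = descWord (r - k) (k + 1) := by
  have key : ∀ l m, (List.range (m + l)).reverse.take l = descWord m l := by
    intro l
    induction l with
    | zero => intro m; simp [descWord]
    | succ l ih =>
      intro m
      rw [← Nat.add_assoc, List.range_succ, List.reverse_append]
      simp [descWord, ih]
  have h := key (k + 1) (r - k)
  rwa [show r - k + (k + 1) = r + 1 by omega] at h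

theorem aApplyB_append (κ : ℝ) (rk : P → ℕ) (v w : List ℕ) (π : P → ℝ) :
    aApplyB κ rk (v ++ w) π = aApplyB κ rk v (aApplyB κ rk w π) := by
  induction v with
  | nil => rfl
  | cons i v ih => simp only [List.cons_append, aApplyB, ih]

/-- The labeling obtained after the first `m` of the partial rowmotions composing rowvacuation. -/
noncomputable def rvacStage (κ : ℝ) (rk : P → ℕ) (r : ℕ) (π : P → ℝ) : ℕ → P → ℝ
  | 0 => π
  | m + 1 => aApplyB κ rk (descWord m (r + 1 - m)) (rvacStage κ rk r π m)

theorem RvacAB_eq_rvacStage (κ : ℝ) (rk : P → ℕ) (r : ℕ) (π : P → ℝ) :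
    RvacAB κ rk r π = rvacStage κ rk r π (r + 1) := by
  have key : ∀ l s, s + l = r + 1 →
      aApplyB κ rk ((List.range' s l).foldr
        (fun k acc => (List.range (r + 1)).reverse.take (k + 1) ++ acc) []) π =
      rvacStage κ rk r π l := by
    intro l
    induction l with
    | zero => intro s _; rfl
    | succ l ih =>
      intro s hs
      rw [List.range'_succ, List.foldr_cons, aApplyB_append, ih (s + 1) (by omega),
        take_reverse_range r s (by omega), rvacStage, show r - s = l by omega,
        show r + 1 - l = s + 1 by omega]
  rw [← key (r + 1) 0 (by omega), ← List.range_eq_range']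
  rfl

variable {κ : ℝ} {rk : P → ℕ} {r : ℕ}

theorem aApplyB_descWord (hκ : 0 < κ) (hrk : StrictMono rk) {σ : P → ℝ} (hσ : ∀ x, 0 < σ x)
    (m l : ℕ) :
    (∀ x, 0 < aApplyB κ rk (descWord m l) σ x) ∧
    (∀ x, rk x < m ∨ m + l ≤ rk x → aApplyB κ rk (descWord m l) σ x = σ x) ∧
    (∀ x, m ≤ rk x → rk x < m + l → aApplyB κ rk (descWord m l) σ x =
      κ / (upSum σ x * downSumErase (aApplyB κ rk (descWord m l) σ) x)) := by
  induction l with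
  | zero => exact ⟨hσ, fun _ _ => rfl, fun x h1 h2 => by omega⟩
  | succ l ih =>
    obtain ⟨ih1, ih2, ih3⟩ := ih
    set τ := aApplyB κ rk (descWord m l) σ
    have hdef : aApplyB κ rk (descWord m (l + 1)) σ = arankToggleB κ rk (m + l) τ := rfl
    rw [hdef]
    have hne : ∀ x, rk x ≠ m + l → arankToggleB κ rk (m + l) τ x = τ x := fun x hx => if_neg hx
    have heq : ∀ x, rk x = m + l →
        arankToggleB κ rk (m + l) τ x = κ / (upSum τ x * downSumErase τ x) := fun x hx => by
      rw [← chainSum_eq]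
      exact if_pos hx
    have hdown : ∀ x, rk x ≤ m + l →
        downSumErase (arankToggleB κ rk (m + l) τ) x = downSumErase τ x := fun x hx =>
      downSumErase_congr fun y hy => hne y (by have := hrk hy; omega)
    refine ⟨fun x => ?_, fun x hx => ?_, fun x h1 h2 => ?_⟩
    · by_cases hx : rk x = m + l
      · rw [heq x hx]
        exact div_pos hκ (mul_pos (upSum_pos ih1 x) (downSumErase_pos ih1 x))
      · rw [hne x hx]
        exact ih1 x
    · rw [hne x (by omega), ih2 x (by omega)]
    · rw [hdown x (by omega)]
      by_cases hx : rk x = m + l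
      · rw [heq x hx]
        congr 2
        exact upSum_congr fun y hy => ih2 y (Or.inr (by have := hrk.monotone hy; omega))
      · rw [hne x hx, ih3 x h1 (by omega)]

theorem rvacStage_pos (hκ : 0 < κ) (hrk : StrictMono rk) {π : P → ℝ} (hπ : ∀ x, 0 < π x)
    (m : ℕ) (x : P) : 0 < rvacStage κ rk r π m x := by
  induction m generalizing x with
  | zero => exact hπ x
  | succ m ih => exact (aApplyB_descWord hκ hrk ih m _).1 x

theorem rvacStage_succ_of_lt (hκ : 0 < κ) (hrk : StrictMono rk) {π : P → ℝ}
    (hπ : ∀ x, 0 < π x) {m : ℕ} {x : P} (hx : rk x < m) :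
    rvacStage κ rk r π (m + 1) x = rvacStage κ rk r π m x :=
  (aApplyB_descWord hκ hrk (rvacStage_pos hκ hrk hπ m) m _).2.1 x (Or.inl hx)

theorem rvacStage_succ_of_le (hκ : 0 < κ) (hrk : StrictMono rk) (hr : ∀ x, rk x ≤ r)
    {π : P → ℝ} (hπ : ∀ x, 0 < π x) {m : ℕ} {x : P} (hx : m ≤ rk x) :
    rvacStage κ rk r π (m + 1) x = κ / (upSum (rvacStage κ rk r π m) x *
      downSumErase (rvacStage κ rk r π (m + 1)) x) :=
  (aApplyB_descWord hκ hrk (rvacStage_pos hκ hrk hπ m) m _).2.2 x hx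
    (by have := hr x; omega)

theorem rvacStage_of_lt (hκ : 0 < κ) (hrk : StrictMono rk) {π : P → ℝ}
    (hπ : ∀ x, 0 < π x) {m m' : ℕ} (hm : m ≤ m') {x : P} (hx : rk x < m) :
    rvacStage κ rk r π m' x = rvacStage κ rk r π m x := by
  induction m', hm using Nat.le_induction with
  | base => rfl
  | succ k hk ih => rw [rvacStage_succ_of_lt hκ hrk hπ (by omega), ih]

theorem RvacAB_apply (hκ : 0 < κ) (hrk : StrictMono rk) (hr : ∀ x, rk x ≤ r) {π : P → ℝ}
    (hπ : ∀ x, 0 < π x) (x : P) :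
    RvacAB κ rk r π x = rvacStage κ rk r π (rk x + 1) x := by
  rw [RvacAB_eq_rvacStage]
  exact rvacStage_of_lt hκ hrk hπ (by have := hr x; omega) (by omega)

theorem downSum_rvacStage_succ (hκ : 0 < κ) (hrk : StrictMono rk) (hr : ∀ x, rk x ≤ r)
    {π : P → ℝ} (hπ : ∀ x, 0 < π x) {m : ℕ} {x : P} (hx : m ≤ rk x) :
    downSum (rvacStage κ rk r π (m + 1)) x = κ / upSum (rvacStage κ rk r π m) x := by
  have h1 := upSum_pos (rvacStage_pos (r := r) hκ hrk hπ m) x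
  have h2 := downSumErase_pos (rvacStage_pos (r := r) hκ hrk hπ (m + 1)) x
  rw [downSum_eq_mul, rvacStage_succ_of_le hκ hrk hr hπ hx]
  field_simp

theorem rvacStage_succ_of_isMin (hκ : 0 < κ) (hrk : StrictMono rk) (hr : ∀ x, rk x ≤ r)
    {π : P → ℝ} (hπ : ∀ x, 0 < π x) {m : ℕ} {x : P} (hx : m ≤ rk x) (hmin : IsMin x) :
    rvacStage κ rk r π (m + 1) x * upSum (rvacStage κ rk r π m) x = κ := by
  have h1 := upSum_pos (rvacStage_pos (r := r) hκ hrk hπ m) x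
  rw [rvacStage_succ_of_le hκ hrk hr hπ hx,
    downSumErase_of_isMin (rvacStage_pos hκ hrk hπ (m + 1)) hmin]
  field_simp

theorem rvacStage_succ_mul (hκ : 0 < κ) (hrk : StrictMono rk) (hr : ∀ x, rk x ≤ r)
    (hcov : ∀ y x, y ⋖ x → rk x = rk y + 1)
    {π : P → ℝ} (hπ : ∀ x, 0 < π x) {m : ℕ} {x : P} (hx : m + 1 ≤ rk x) (hmin : ¬ IsMin x) :
    rvacStage κ rk r π (m + 1) x * (upSum (rvacStage κ rk r π m) x *
      ∑ y ∈ Finset.univ.filter (· ⋖ x), (upSum (rvacStage κ rk r π m) y)⁻¹) = 1 := by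
  have h0 := rvacStage_pos (r := r) hκ hrk hπ (m + 1) x
  have h1 := upSum_pos (rvacStage_pos (r := r) hκ hrk hπ m) x
  have h2 := downSumErase_pos (rvacStage_pos (r := r) hκ hrk hπ (m + 1)) x
  have h3 := rvacStage_succ_of_le hκ hrk hr hπ (m := m) (x := x) (by omega)
  have h4 : downSumErase (rvacStage κ rk r π (m + 1)) x =
      κ * ∑ y ∈ Finset.univ.filter (· ⋖ x), (upSum (rvacStage κ rk r π m) y)⁻¹ := by
    rw [downSumErase_of_not_isMin (rvacStage_pos hκ hrk hπ (m + 1)) hmin, Finset.mul_sum]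
    refine Finset.sum_congr rfl fun y hy => ?_
    have := hcov y x (Finset.mem_filter.1 hy).2
    rw [downSum_rvacStage_succ hκ hrk hr hπ (by omega), div_eq_mul_inv]
  rw [eq_div_iff (mul_pos h1 h2).ne', h4] at h3
  refine mul_left_cancel₀ hκ.ne' ?_
  linear_combination h3

theorem RvacAB_mul (hκ : 0 < κ) (hrk : StrictMono rk) (hr : ∀ x, rk x ≤ r)
    (hcov : ∀ y x, y ⋖ x → rk x = rk y + 1)
    {π : P → ℝ} (hπ : ∀ x, 0 < π x) {m : ℕ} {x : P} (hx : rk x = m + 1) (hmin : ¬ IsMin x) :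
    RvacAB κ rk r π x * (upSum (rvacStage κ rk r π (m + 1)) x *
      ∑ y ∈ Finset.univ.filter (· ⋖ x), (upSum (rvacStage κ rk r π m) y)⁻¹) = 1 := by
  rw [RvacAB_apply hκ hrk hr hπ, hx]
  have h1 := upSum_pos (rvacStage_pos (r := r) hκ hrk hπ (m + 1)) x
  have h2 := downSumErase_pos (rvacStage_pos (r := r) hκ hrk hπ (m + 2)) x
  have h3 := rvacStage_succ_of_le hκ hrk hr hπ (m := m + 1) (x := x) hx.ge
  have h4 : downSumErase (rvacStage κ rk r π (m + 2)) x =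
      κ * ∑ y ∈ Finset.univ.filter (· ⋖ x), (upSum (rvacStage κ rk r π m) y)⁻¹ := by
    rw [downSumErase_congr (π' := rvacStage κ rk r π (m + 1)) fun y hy =>
        rvacStage_succ_of_lt hκ hrk hπ (by have := hrk hy; omega),
      downSumErase_of_not_isMin (rvacStage_pos hκ hrk hπ (m + 1)) hmin, Finset.mul_sum]
    refine Finset.sum_congr rfl fun y hy => ?_
    have := hcov y x (Finset.mem_filter.1 hy).2
    rw [downSum_rvacStage_succ hκ hrk hr hπ (by omega), div_eq_mul_inv]
  rw [eq_div_iff (mul_pos h1 h2).ne', h4] at h3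
  refine mul_left_cancel₀ hκ.ne' ?_
  linear_combination h3

end Rowvacuation

section QuotientPoset

variable {n : ℕ}

theorem toBP_val_of_le {i j : ℕ} (h : 1 ≤ i ∧ i ≤ j ∧ j ≤ 2 * n) (hij : i + j ≤ 2 * n + 1) :
    (toBP n (i, j) h).val = (i, j) :=
  congrArg Subtype.val (dif_pos hij)

theorem toBP_val_of_lt {i j : ℕ} (h : 1 ≤ i ∧ i ≤ j ∧ j ≤ 2 * n) (hij : 2 * n + 1 < i + j) :
    (toBP n (i, j) h).val = (2 * n + 1 - j, 2 * n + 1 - i) :=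
  congrArg Subtype.val (dif_neg hij.not_ge)

theorem rkBP_toBP {i j : ℕ} (h : 1 ≤ i ∧ i ≤ j ∧ j ≤ 2 * n) :
    rkBP n (toBP n (i, j) h) = j - i := by
  unfold rkBP
  rcases le_or_gt (i + j) (2 * n + 1) with hij | hij
  · rw [toBP_val_of_le h hij]
  · rw [toBP_val_of_lt h hij]
    omega

theorem toBP_le_toBP {i j a b : ℕ} (h : 1 ≤ i ∧ i ≤ j ∧ j ≤ 2 * n)
    (h' : 1 ≤ a ∧ a ≤ b ∧ b ≤ 2 * n) :
    toBP n (i, j) h ≤ toBP n (a, b) h' ↔ BPle n (i, j) (a, b) := by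
  change BPle n (toBP n (i, j) h).val (toBP n (a, b) h').val ↔ _
  rcases le_or_gt (i + j) (2 * n + 1) with hij | hij <;>
    rcases le_or_gt (a + b) (2 * n + 1) with hab | hab <;>
    simp only [toBP_val_of_le, toBP_val_of_lt, hij, hab, BPle] <;> omega

theorem toBP_flip {i j : ℕ} (h : 1 ≤ i ∧ i ≤ j ∧ j ≤ 2 * n)
    (h' : 1 ≤ 2 * n + 1 - j ∧ 2 * n + 1 - j ≤ 2 * n + 1 - i ∧ 2 * n + 1 - i ≤ 2 * n) :
    toBP n (2 * n + 1 - j, 2 * n + 1 - i) h' = toBP n (i, j) h := by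
  apply le_antisymm <;> rw [toBP_le_toBP, BPle] <;> omega

theorem exists_toBP (x : BP n) : ∃ i j h, x = toBP n (i, j) h := by
  obtain ⟨⟨i, j⟩, hx⟩ := x
  refine ⟨i, j, ⟨hx.1, hx.2.1, hx.2.2.1⟩, ?_⟩
  exact Subtype.ext (toBP_val_of_le _ hx.2.2.2).symm

theorem exists_toBP_of_le {i j : ℕ} {h : 1 ≤ i ∧ i ≤ j ∧ j ≤ 2 * n} {z : BP n}
    (hz : toBP n (i, j) h ≤ z) : ∃ a b h', z = toBP n (a, b) h' ∧ a ≤ i ∧ j ≤ b := by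
  obtain ⟨a, b, h', rfl⟩ := exists_toBP z
  rw [toBP_le_toBP] at hz
  rcases hz with hz | hz
  · exact ⟨a, b, h', rfl, hz⟩
  · exact ⟨2 * n + 1 - b, 2 * n + 1 - a, by dsimp only at *; omega, (toBP_flip _ _).symm, hz⟩

theorem exists_toBP_of_ge {i j : ℕ} {h : 1 ≤ i ∧ i ≤ j ∧ j ≤ 2 * n} {z : BP n}
    (hz : z ≤ toBP n (i, j) h) : ∃ a b h', z = toBP n (a, b) h' ∧ i ≤ a ∧ b ≤ j := by
  obtain ⟨a, b, h', rfl⟩ := exists_toBP z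
  rw [toBP_le_toBP] at hz
  simp only [BPle] at hz
  rcases hz with hz | hz
  · exact ⟨a, b, h', rfl, hz⟩
  · exact ⟨2 * n + 1 - b, 2 * n + 1 - a, by dsimp only at *; omega, (toBP_flip _ _).symm,
      by dsimp only at *; omega⟩

theorem rkBP_strictMono : StrictMono (rkBP n) := by
  intro x z hxz
  obtain ⟨i, j, h, rfl⟩ := exists_toBP x
  obtain ⟨a, b, h', rfl, h1, h2⟩ := exists_toBP_of_le hxz.le
  rw [rkBP_toBP, rkBP_toBP]
  rcases h1.eq_or_lt with rfl | h1
  · rcases h2.eq_or_lt with rfl | h2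
    · exact absurd hxz (lt_irrefl _)
    · omega
  · omega

theorem rkBP_le (x : BP n) : rkBP n x ≤ 2 * n - 1 := by
  obtain ⟨i, j, h, rfl⟩ := exists_toBP x
  rw [rkBP_toBP]
  dsimp only at h
  omega

theorem covBy_of_le_of_rkBP {x z : BP n} (hle : x ≤ z) (hrk : rkBP n z = rkBP n x + 1) :
    x ⋖ z := by
  refine ⟨lt_of_le_of_ne hle ?_, fun w h1 h2 => ?_⟩
  · rintro rfl
    omega
  · have := rkBP_strictMono h1
    have := rkBP_strictMono h2
    omega

theorem toBP_covBy_left {i j : ℕ} (h : 1 ≤ i ∧ i ≤ j ∧ j ≤ 2 * n)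
    (h' : 1 ≤ i + 1 ∧ i + 1 ≤ j ∧ j ≤ 2 * n) : toBP n (i + 1, j) h' ⋖ toBP n (i, j) h := by
  apply covBy_of_le_of_rkBP
  · rw [toBP_le_toBP, BPle]
    omega
  · rw [rkBP_toBP, rkBP_toBP]
    omega

theorem toBP_covBy_right {i j : ℕ} (h : 1 ≤ i ∧ i ≤ j ∧ j ≤ 2 * n)
    (h' : 1 ≤ i ∧ i ≤ j + 1 ∧ j + 1 ≤ 2 * n) : toBP n (i, j) h ⋖ toBP n (i, j + 1) h' := by
  apply covBy_of_le_of_rkBP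
  · rw [toBP_le_toBP, BPle]
    omega
  · rw [rkBP_toBP, rkBP_toBP]
    omega

theorem toBP_covBy_iff {i j : ℕ} (h : 1 ≤ i ∧ i ≤ j ∧ j ≤ 2 * n) (z : BP n) :
    toBP n (i, j) h ⋖ z ↔
      (∃ k h', i = k + 1 ∧ z = toBP n (k, j) h') ∨ (∃ h', z = toBP n (i, j + 1) h') := by
  constructor
  · intro hz
    obtain ⟨a, b, h', rfl, h1, h2⟩ := exists_toBP_of_le hz.le
    dsimp only at h h'
    rcases h1.eq_or_lt with rfl | h1
    · rcases h2.eq_or_lt with rfl | h2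
      · exact absurd hz.lt (lt_irrefl _)
      · right
        have hv : 1 ≤ a ∧ a ≤ j + 1 ∧ j + 1 ≤ 2 * n := by omega
        have hle : toBP n (a, j + 1) hv ≤ toBP n (a, b) h' := by
          rw [toBP_le_toBP, BPle]
          omega
        exact ⟨hv, (hle.eq_or_lt.resolve_right (hz.2 (toBP_covBy_right h hv).lt)).symm⟩
    · left
      obtain ⟨k, rfl⟩ : ∃ k, i = k + 1 := ⟨i - 1, by omega⟩
      have hv : 1 ≤ k ∧ k ≤ j ∧ j ≤ 2 * n := by omega
      have hle : toBP n (k, j) hv ≤ toBP n (a, b) h' := by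
        rw [toBP_le_toBP, BPle]
        omega
      exact ⟨k, hv, rfl, (hle.eq_or_lt.resolve_right (hz.2 (toBP_covBy_left hv h).lt)).symm⟩
  · rintro (⟨k, h', rfl, rfl⟩ | ⟨h', rfl⟩)
    · exact toBP_covBy_left h' h
    · exact toBP_covBy_right h h'

theorem covBy_toBP_iff {i j : ℕ} (h : 1 ≤ i ∧ i ≤ j ∧ j ≤ 2 * n) (y : BP n) :
    y ⋖ toBP n (i, j) h ↔
      (∃ h', y = toBP n (i + 1, j) h') ∨ (∃ k h', j = k + 1 ∧ y = toBP n (i, k) h') := by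
  constructor
  · intro hy
    obtain ⟨a, b, h', rfl, h1, h2⟩ := exists_toBP_of_ge hy.le
    dsimp only at h h'
    rcases h1.eq_or_lt with rfl | h1
    · rcases h2.eq_or_lt with rfl | h2
      · exact absurd hy.lt (lt_irrefl _)
      · right
        obtain ⟨k, rfl⟩ : ∃ k, j = k + 1 := ⟨j - 1, by omega⟩
        have hv : 1 ≤ i ∧ i ≤ k ∧ k ≤ 2 * n := by omega
        have hle : toBP n (i, b) h' ≤ toBP n (i, k) hv := by
          rw [toBP_le_toBP, BPle]
          omega
        exact ⟨k, hv, rfl, hle.eq_or_lt.resolve_right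
          fun hlt => hy.2 hlt (toBP_covBy_right hv h).lt⟩
    · left
      have hv : 1 ≤ i + 1 ∧ i + 1 ≤ j ∧ j ≤ 2 * n := by omega
      have hle : toBP n (a, b) h' ≤ toBP n (i + 1, j) hv := by
        rw [toBP_le_toBP, BPle]
        omega
      exact ⟨hv, hle.eq_or_lt.resolve_right fun hlt => hy.2 hlt (toBP_covBy_left h hv).lt⟩
  · rintro (⟨h', rfl⟩ | ⟨k, h', rfl, rfl⟩)
    · exact toBP_covBy_left h h'
    · exact toBP_covBy_right h' h

theorem rkBP_of_covBy (y x : BP n) (hyx : y ⋖ x) : rkBP n x = rkBP n y + 1 := by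
  obtain ⟨i, j, h, rfl⟩ := exists_toBP y
  rcases (toBP_covBy_iff h x).1 hyx with ⟨k, h', rfl, rfl⟩ | ⟨h', rfl⟩ <;>
    rw [rkBP_toBP, rkBP_toBP] <;> dsimp only at * <;> omega

/-- The extension of a labeling of `B'ⁿ` to pairs `(i, j)`, with value `1` outside `A^{2n}`. -/
noncomputable def liftBP (f : BP n → ℝ) (i j : ℕ) : ℝ :=
  if h : 1 ≤ i ∧ i ≤ j ∧ j ≤ 2 * n then f (toBP n (i, j) h) else 1

theorem liftBP_of_mem (f : BP n → ℝ) {i j : ℕ} (h : 1 ≤ i ∧ i ≤ j ∧ j ≤ 2 * n) :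
    liftBP f i j = f (toBP n (i, j) h) := dif_pos h

theorem liftBP_pos {f : BP n → ℝ} (hf : ∀ x, 0 < f x) (i j : ℕ) : 0 < liftBP f i j := by
  unfold liftBP
  split_ifs
  · exact hf _
  · exact one_pos

theorem liftBP_flip (f : BP n → ℝ) {i j : ℕ} (h : 1 ≤ i ∧ i ≤ j ∧ j ≤ 2 * n) :
    liftBP f (2 * n + 1 - j) (2 * n + 1 - i) = liftBP f i j := by
  rw [liftBP_of_mem f h, liftBP_of_mem f (by omega), toBP_flip]

/-- The sum of the inverse labels of the elements covered by the orbit of `[i, j]`. -/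
noncomputable def invSumBelow (f : BP n → ℝ) (i j : ℕ) : ℝ :=
  liftBP (fun x => ∑ y ∈ Finset.univ.filter (· ⋖ x), (f y)⁻¹) i j

theorem filter_toBP_covBy {i j : ℕ} (h : 1 ≤ i + 1 ∧ i + 1 ≤ j ∧ j ≤ 2 * n)
    (h1 : 1 ≤ i ∧ i ≤ j ∧ j ≤ 2 * n) (h2 : 1 ≤ i + 1 ∧ i + 1 ≤ j + 1 ∧ j + 1 ≤ 2 * n) :
    Finset.univ.filter (toBP n (i + 1, j) h ⋖ ·) =
      {toBP n (i, j) h1, toBP n (i + 1, j + 1) h2} := by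
  ext z
  simp only [Finset.mem_filter, Finset.mem_univ, true_and, Finset.mem_insert,
    Finset.mem_singleton, toBP_covBy_iff]
  constructor
  · rintro (⟨k, h', hk, rfl⟩ | ⟨h', rfl⟩)
    · obtain rfl : i = k := by omega
      exact Or.inl rfl
    · exact Or.inr rfl
  · rintro (rfl | rfl)
    · exact Or.inl ⟨i, h1, rfl, rfl⟩
    · exact Or.inr ⟨h2, rfl⟩

theorem filter_covBy_toBP {i j : ℕ} (h : 1 ≤ i ∧ i ≤ j + 1 ∧ j + 1 ≤ 2 * n)
    (h1 : 1 ≤ i ∧ i ≤ j ∧ j ≤ 2 * n) (h2 : 1 ≤ i + 1 ∧ i + 1 ≤ j + 1 ∧ j + 1 ≤ 2 * n) :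
    Finset.univ.filter (· ⋖ toBP n (i, j + 1) h) =
      {toBP n (i, j) h1, toBP n (i + 1, j + 1) h2} := by
  ext y
  simp only [Finset.mem_filter, Finset.mem_univ, true_and, Finset.mem_insert,
    Finset.mem_singleton, covBy_toBP_iff]
  constructor
  · rintro (⟨h', rfl⟩ | ⟨k, h', hk, rfl⟩)
    · exact Or.inr rfl
    · obtain rfl : j = k := by omega
      exact Or.inl rfl
  · rintro (rfl | rfl)
    · exact Or.inr ⟨j, h1, rfl, rfl⟩
    · exact Or.inl ⟨h2, rfl⟩

theorem liftBP_upSum_interior {σ : BP n → ℝ} (hσ : ∀ x, 0 < σ x) {i j : ℕ} (hi : 1 ≤ i)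
    (hij : i + 1 ≤ j) (hj : j + 1 ≤ 2 * n) :
    liftBP (upSum σ) (i + 1) j = liftBP σ (i + 1) j * (liftBP (upSum σ) i j *
      liftBP (upSum σ) (i + 1) (j + 1) * invSumBelow (upSum σ) i (j + 1)) := by
  have h : 1 ≤ i + 1 ∧ i + 1 ≤ j ∧ j ≤ 2 * n := by omega
  have h0 : 1 ≤ i ∧ i ≤ j + 1 ∧ j + 1 ≤ 2 * n := by omega
  have h1 : 1 ≤ i ∧ i ≤ j ∧ j ≤ 2 * n := by omega
  have h2 : 1 ≤ i + 1 ∧ i + 1 ≤ j + 1 ∧ j + 1 ≤ 2 * n := by omega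
  unfold invSumBelow
  rw [liftBP_of_mem _ h, liftBP_of_mem _ h, liftBP_of_mem _ h0, liftBP_of_mem _ h1,
    liftBP_of_mem _ h2, upSum_of_not_isMax σ fun hm => (toBP_covBy_left h1 h).lt.not_ge
      (hm (toBP_covBy_left h1 h).le), filter_toBP_covBy h h1 h2, filter_covBy_toBP h0 h1 h2]
  congr 1
  have p1 := upSum_pos hσ (toBP n (i, j) h1)
  have p2 := upSum_pos hσ (toBP n (i + 1, j + 1) h2)
  by_cases heq : toBP n (i, j) h1 = toBP n (i + 1, j + 1) h2
  · rw [heq] at p1 ⊢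
    simp only [Finset.pair_eq_singleton, Finset.sum_singleton]
    field_simp
  · rw [Finset.sum_pair heq, Finset.sum_pair heq]
    field_simp
    ring

theorem liftBP_upSum_one (σ : BP n → ℝ) {j : ℕ} (hj : 1 ≤ j) (hjn : j + 1 ≤ 2 * n) :
    liftBP (upSum σ) 1 j = liftBP σ 1 j * liftBP (upSum σ) 1 (j + 1) := by
  have h : 1 ≤ 1 ∧ 1 ≤ j ∧ j ≤ 2 * n := by omega
  have h1 : 1 ≤ 1 ∧ 1 ≤ j + 1 ∧ j + 1 ≤ 2 * n := by omega
  have hf : Finset.univ.filter (toBP n (1, j) h ⋖ ·) = {toBP n (1, j + 1) h1} := by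
    ext z
    simp only [Finset.mem_filter, Finset.mem_univ, true_and, Finset.mem_singleton,
      toBP_covBy_iff]
    constructor
    · rintro (⟨k, h', hk, rfl⟩ | ⟨h', rfl⟩)
      · omega
      · rfl
    · rintro rfl
      exact Or.inr ⟨h1, rfl⟩
  rw [liftBP_of_mem _ h, liftBP_of_mem _ h, liftBP_of_mem _ h1,
    upSum_of_not_isMax σ fun hm => (toBP_covBy_right h h1).lt.not_ge
      (hm (toBP_covBy_right h h1).le), hf, Finset.sum_singleton]

theorem liftBP_upSum_last (σ : BP n → ℝ) {i : ℕ} (hi : 1 ≤ i) (hin : i ≤ 2 * n) :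
    liftBP (upSum σ) i (2 * n) = ∏ j ∈ Finset.Icc 1 i, liftBP σ j (2 * n) := by
  induction i, hi using Nat.le_induction with
  | base =>
    have h : 1 ≤ 1 ∧ 1 ≤ 2 * n ∧ 2 * n ≤ 2 * n := by omega
    rw [Finset.Icc_self, Finset.prod_singleton, liftBP_of_mem _ h, liftBP_of_mem _ h,
      upSum_of_isMax]
    intro z hz
    obtain ⟨a, b, h', rfl, h1, h2⟩ := exists_toBP_of_le hz
    dsimp only at h'
    rw [toBP_le_toBP, BPle]
    omega
  | succ i hi ih =>
    have h : 1 ≤ i + 1 ∧ i + 1 ≤ 2 * n ∧ 2 * n ≤ 2 * n := by omega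
    have h1 : 1 ≤ i ∧ i ≤ 2 * n ∧ 2 * n ≤ 2 * n := by omega
    have hf : Finset.univ.filter (toBP n (i + 1, 2 * n) h ⋖ ·) = {toBP n (i, 2 * n) h1} := by
      ext z
      simp only [Finset.mem_filter, Finset.mem_univ, true_and, Finset.mem_singleton,
        toBP_covBy_iff]
      constructor
      · rintro (⟨k, h', hk, rfl⟩ | ⟨h', rfl⟩)
        · obtain rfl : i = k := by omega
          rfl
        · omega
      · rintro rfl
        exact Or.inl ⟨i, h1, rfl, rfl⟩
    rw [Finset.prod_Icc_succ_top (by omega), ← ih (by omega), liftBP_of_mem _ h,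
      liftBP_of_mem _ h, liftBP_of_mem _ h1,
      upSum_of_not_isMax σ fun hm => (toBP_covBy_left h1 h).lt.not_ge
        (hm (toBP_covBy_left h1 h).le), hf, Finset.sum_singleton, mul_comm]

end QuotientPoset

section Homomesy

variable {n : ℕ} {κ : ℝ} {π : BP n → ℝ}

theorem not_isMin_toBP {i j : ℕ} (h : 1 ≤ i ∧ i ≤ j ∧ j ≤ 2 * n) (hij : i < j) :
    ¬ IsMin (toBP n (i, j) h) := fun hm => by
  have hc := toBP_covBy_left h (by omega)
  exact hc.lt.not_ge (hm hc.le)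

theorem isMin_toBP {i : ℕ} (h : 1 ≤ i ∧ i ≤ i ∧ i ≤ 2 * n) : IsMin (toBP n (i, i) h) := by
  intro z hz
  rcases hz.eq_or_lt with rfl | hlt
  · exact le_rfl
  · have := rkBP_strictMono hlt
    rw [rkBP_toBP] at this
    omega

theorem liftBP_rvacStage_succ_mul (hκ : 0 < κ) (hπ : ∀ x, 0 < π x) {m i j : ℕ} (hi : 1 ≤ i)
    (hij : i + m + 1 ≤ j) (hj : j ≤ 2 * n) :
    liftBP (rvacStage κ (rkBP n) (2 * n - 1) π (m + 1)) i j *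
      (liftBP (upSum (rvacStage κ (rkBP n) (2 * n - 1) π m)) i j *
        invSumBelow (upSum (rvacStage κ (rkBP n) (2 * n - 1) π m)) i j) = 1 := by
  have h : 1 ≤ i ∧ i ≤ j ∧ j ≤ 2 * n := by omega
  unfold invSumBelow
  rw [liftBP_of_mem _ h, liftBP_of_mem _ h, liftBP_of_mem _ h]
  exact rvacStage_succ_mul hκ rkBP_strictMono rkBP_le rkBP_of_covBy hπ
    (by rw [rkBP_toBP]; omega) (not_isMin_toBP h (by omega))

theorem liftBP_RvacAB_mul (hκ : 0 < κ) (hπ : ∀ x, 0 < π x) {m i : ℕ} (hi : 1 ≤ i)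
    (hj : i + m + 1 ≤ 2 * n) :
    liftBP (RvacAB κ (rkBP n) (2 * n - 1) π) i (i + m + 1) *
      (liftBP (upSum (rvacStage κ (rkBP n) (2 * n - 1) π (m + 1))) i (i + m + 1) *
        invSumBelow (upSum (rvacStage κ (rkBP n) (2 * n - 1) π m)) i (i + m + 1)) = 1 := by
  have h : 1 ≤ i ∧ i ≤ i + m + 1 ∧ i + m + 1 ≤ 2 * n := by omega
  unfold invSumBelow
  rw [liftBP_of_mem _ h, liftBP_of_mem _ h, liftBP_of_mem _ h]
  exact RvacAB_mul hκ rkBP_strictMono rkBP_le rkBP_of_covBy hπ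
    (by rw [rkBP_toBP]; omega) (not_isMin_toBP h (by omega))

theorem liftBP_RvacAB_diag (hκ : 0 < κ) (hπ : ∀ x, 0 < π x) {i : ℕ} (hi : 1 ≤ i)
    (hin : i ≤ 2 * n) :
    liftBP (RvacAB κ (rkBP n) (2 * n - 1) π) i i * liftBP (upSum π) i i = κ := by
  have h : 1 ≤ i ∧ i ≤ i ∧ i ≤ 2 * n := by omega
  have hr : rkBP n (toBP n (i, i) h) = 0 := by rw [rkBP_toBP]; omega
  rw [liftBP_of_mem _ h, liftBP_of_mem _ h, RvacAB_apply hκ rkBP_strictMono rkBP_le hπ, hr]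
  exact rvacStage_succ_of_isMin (m := 0) hκ rkBP_strictMono rkBP_le hπ (Nat.zero_le _)
    (isMin_toBP h)

theorem prod_liftBP_rvacStage_succ (hκ : 0 < κ) (hπ : ∀ x, 0 < π x) {m t c : ℕ} (ht : 1 ≤ t)
    (htc : t + m ≤ c) (hc : c + 1 ≤ 2 * n) :
    (∏ j ∈ Finset.Icc 1 t, liftBP (rvacStage κ (rkBP n) (2 * n - 1) π (m + 1)) j (c + 1)) *
      (liftBP (upSum (rvacStage κ (rkBP n) (2 * n - 1) π m)) t c *
        invSumBelow (upSum (rvacStage κ (rkBP n) (2 * n - 1) π m)) t (c + 1)) =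
    ∏ j ∈ Finset.Icc 1 t, liftBP (rvacStage κ (rkBP n) (2 * n - 1) π m) j c := by
  induction t, ht using Nat.le_induction with
  | base =>
    have h1 := liftBP_rvacStage_succ_mul hκ hπ (m := m) (i := 1) (j := c + 1) le_rfl
      (by omega) hc
    have h2 := liftBP_upSum_one (rvacStage κ (rkBP n) (2 * n - 1) π m) (j := c) (by omega) hc
    rw [Finset.Icc_self, Finset.prod_singleton, Finset.prod_singleton, h2]
    linear_combination liftBP (rvacStage κ (rkBP n) (2 * n - 1) π m) 1 c * h1
  | succ t ht ih =>
    have h1 := liftBP_rvacStage_succ_mul hκ hπ (m := m) (i := t + 1) (j := c + 1) (by omega)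
      (by omega) hc
    have h2 := liftBP_upSum_interior (rvacStage_pos (r := 2 * n - 1) hκ rkBP_strictMono hπ m)
      (i := t) (j := c) ht (by omega) hc
    rw [Finset.prod_Icc_succ_top (by omega), Finset.prod_Icc_succ_top (by omega),
      ← ih (by omega), h2]
    linear_combination
      (∏ j ∈ Finset.Icc 1 t, liftBP (rvacStage κ (rkBP n) (2 * n - 1) π (m + 1)) j (c + 1)) *
        liftBP (rvacStage κ (rkBP n) (2 * n - 1) π m) (t + 1) c *
        (liftBP (upSum (rvacStage κ (rkBP n) (2 * n - 1) π m)) t c *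
        invSumBelow (upSum (rvacStage κ (rkBP n) (2 * n - 1) π m)) t (c + 1)) * h1

theorem prod_row_mul_prod_column (hκ : 0 < κ) (hπ : ∀ x, 0 < π x) {i : ℕ} (hi : 1 ≤ i)
    (hin : i ≤ 2 * n) :
    (∏ j ∈ Finset.Icc i (2 * n), liftBP (RvacAB κ (rkBP n) (2 * n - 1) π) i j) *
      ∏ j ∈ Finset.Icc 1 i, liftBP π j i = κ := by
  have key : ∀ m, i + m ≤ 2 * n →
      (∏ j ∈ Finset.Icc i (i + m), liftBP (RvacAB κ (rkBP n) (2 * n - 1) π) i j) *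
        (∏ j ∈ Finset.Icc 1 i, liftBP π j i) *
        liftBP (upSum (rvacStage κ (rkBP n) (2 * n - 1) π m)) i (i + m) =
      κ * ∏ j ∈ Finset.Icc 1 i,
        liftBP (rvacStage κ (rkBP n) (2 * n - 1) π m) j (i + m) := by
    intro m
    induction m with
    | zero =>
      intro _
      have h := liftBP_RvacAB_diag hκ hπ hi hin
      rw [Nat.add_zero, Finset.Icc_self, Finset.prod_singleton]
      change _ * _ * liftBP (upSum π) i i = κ * ∏ j ∈ Finset.Icc 1 i, liftBP π j i
      linear_combination (∏ j ∈ Finset.Icc 1 i, liftBP π j i) * h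
    | succ m ih =>
      intro hm
      have h0 := ih (by omega)
      have h1 := liftBP_RvacAB_mul hκ hπ (m := m) hi hm
      have h2 := prod_liftBP_rvacStage_succ hκ hπ (m := m) (c := i + m) hi le_rfl hm
      rw [← h2] at h0
      rw [← Nat.add_assoc, Finset.prod_Icc_succ_top (by omega)]
      have p1 := liftBP_pos (upSum_pos
        (rvacStage_pos (r := 2 * n - 1) hκ rkBP_strictMono hπ m)) i (i + m)
      have p2 : invSumBelow (upSum (rvacStage κ (rkBP n) (2 * n - 1) π m)) i (i + m + 1) ≠ 0 :=
        right_ne_zero_of_mul (right_ne_zero_of_mul (h1.trans_ne one_ne_zero))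
      refine mul_right_cancel₀ (mul_ne_zero p1.ne' p2) ?_
      linear_combination h0 +
        (∏ j ∈ Finset.Icc i (i + m), liftBP (RvacAB κ (rkBP n) (2 * n - 1) π) i j) *
        (∏ j ∈ Finset.Icc 1 i, liftBP π j i) *
        liftBP (upSum (rvacStage κ (rkBP n) (2 * n - 1) π m)) i (i + m) * h1
  have h := key (2 * n - i) (by omega)
  rw [show i + (2 * n - i) = 2 * n by omega, ← liftBP_upSum_last _ hi hin] at h
  exact mul_right_cancel₀ (liftBP_pos (upSum_pos
    (rvacStage_pos (r := 2 * n - 1) hκ rkBP_strictMono hπ _)) _ _).ne' h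

theorem prod_row_flip (f : BP n → ℝ) {i : ℕ} (hi : 1 ≤ i) (hin : i ≤ 2 * n) :
    ∏ j ∈ Finset.Icc (2 * n + 1 - i) (2 * n), liftBP f (2 * n + 1 - i) j =
      ∏ j ∈ Finset.Icc 1 i, liftBP f j i := by
  refine Finset.prod_bij' (fun j _ => 2 * n + 1 - j) (fun j _ => 2 * n + 1 - j) ?_ ?_ ?_ ?_ ?_
  · intro j hj
    rw [Finset.mem_Icc] at hj ⊢
    omega
  · intro j hj
    rw [Finset.mem_Icc] at hj ⊢
    omega
  · intro j hj
    rw [Finset.mem_Icc] at hj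
    omega
  · intro j hj
    rw [Finset.mem_Icc] at hj
    omega
  · intro j hj
    rw [Finset.mem_Icc] at hj
    rw [← liftBP_flip f (i := 2 * n + 1 - i) (j := j) (by omega)]
    congr 1
    omega

theorem hBB_eq (i : ℕ) (f : BP n → ℝ) :
    hBB n i f =
      (∏ j ∈ Finset.Icc i (2 * n), liftBP f i j) * ∏ j ∈ Finset.Icc 1 i, liftBP f j i := rfl

end Homomesy

/-- Let `n ≥ 1` and `κ > 0`, and let `B'ⁿ = A^{2n}/⟨Flip⟩`.  For every
`1 ≤ i ≤ 2n` and every `π : B'ⁿ → ℝ>0`, one has `h^B_i(π) · h^B_i(Rvac^B_A π) = κ²`;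
i.e. each `h^B_i` is multiplicatively `κ`-mesic with respect to birational antichain
rowvacuation of `B'ⁿ` (a graded poset of rank `2n - 1`). -/
theorem stmt16 (n : ℕ) (hn : 1 ≤ n) (κ : ℝ) (hκ : 0 < κ)
    (i : ℕ) (hi1 : 1 ≤ i) (hi2 : i ≤ 2 * n)
    (π : BP n → ℝ) (hpos : ∀ x, 0 < π x) :
    hBB n i π * hBB n i (RvacAB κ (rkBP n) (2 * n - 1) π) = κ ^ 2 := by
  have h1 := prod_row_mul_prod_column hκ hpos hi1 hi2
  have h2 := prod_row_mul_prod_column hκ hpos (i := 2 * n + 1 - i) (by omega) (by omega)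
  rw [prod_row_flip _ hi1 hi2, ← prod_row_flip _ (i := 2 * n + 1 - i) (by omega) (by omega),
    show 2 * n + 1 - (2 * n + 1 - i) = i by omega] at h2
  rw [hBB_eq, hBB_eq]
  linear_combination κ * h1 +
    (∏ j ∈ Finset.Icc i (2 * n), liftBP (RvacAB κ (rkBP n) (2 * n - 1) π) i j) *
      (∏ j ∈ Finset.Icc 1 i, liftBP π j i) * h2
end

section
/- For every n ≥ 1, the number of antichains A of A^n satisfying LK(Row_A(A)) = A equals the central binomial coefficient C(n+1, ⌊(n+1)/2⌋). -/
/-- `p` represents an interval `[p.1, p.2]` of the poset `Aⁿ` (so `1 ≤ p.1 ≤ p.2 ≤ n`). -/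
def AnMem (n : ℕ) (p : ℕ × ℕ) : Prop := 1 ≤ p.1 ∧ p.1 ≤ p.2 ∧ p.2 ≤ n

/-- The containment order of `Aⁿ`: `AnLe p q` means `[p.1,p.2] ⊆ [q.1,q.2]`,
i.e. `p ≤ q` in `Aⁿ`. -/
def AnLe (p q : ℕ × ℕ) : Prop := q.1 ≤ p.1 ∧ p.2 ≤ q.2

/-- `A` is an antichain of the poset `Aⁿ`: its members are intervals of `[n]`, and no two
distinct members are comparable under containment. -/
def IsAntichainAn (n : ℕ) (A : Finset (ℕ × ℕ)) : Prop :=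
  (∀ p ∈ A, AnMem n p) ∧ ∀ p ∈ A, ∀ q ∈ A, p ≠ q → ¬ AnLe p q

/-- The Lalanne–Kreweras involution.  Writing the antichain `A` as
`{[i₁,j₁],…,[i_k,j_k]}` with `i₁ < ⋯ < i_k` and `j₁ < ⋯ < j_k`, the image `LK A` consists
of the pairs `[i'_ℓ, j'_ℓ]` where `{i'_1 < ⋯ < i'_m} = [n] \ {j₁,…,j_k}` and
`{j'_1 < ⋯ < j'_m} = [n] \ {i₁,…,i_k}`: we zip the increasing enumeration of the
complement of the second coordinates with that of the first coordinates. -/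
def LK (n : ℕ) (A : Finset (ℕ × ℕ)) : Finset (ℕ × ℕ) :=
  (List.zip
    ((Finset.Icc 1 n \ A.image Prod.snd).sort (· ≤ ·))
    ((Finset.Icc 1 n \ A.image Prod.fst).sort (· ≤ ·))).toFinset

instance (n : ℕ) (p : ℕ × ℕ) : Decidable (AnMem n p) := by unfold AnMem; infer_instance

instance (p q : ℕ × ℕ) : Decidable (AnLe p q) := by unfold AnLe; infer_instance

instance (n : ℕ) (A : Finset (ℕ × ℕ)) : Decidable (IsAntichainAn n A) := by
  unfold IsAntichainAn; infer_instance

/-- The set of elements of the poset `Aⁿ`, as a finset of pairs. -/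
def AnUniv (n : ℕ) : Finset (ℕ × ℕ) :=
  (Finset.Icc 1 n ×ˢ Finset.Icc 1 n).filter (AnMem n)

/-- Antichain rowmotion `Row_A` of `Aⁿ`: the image of an antichain `A` is the set of
minimal elements of `{x : x ≰ y for all y ∈ A}`. -/
def rowA (n : ℕ) (A : Finset (ℕ × ℕ)) : Finset (ℕ × ℕ) :=
  ((AnUniv n).filter (fun p => ∀ q ∈ A, ¬ AnLe p q)).filter
    (fun p => ∀ q ∈ (AnUniv n).filter (fun p' => ∀ q' ∈ A, ¬ AnLe p' q'),
      AnLe q p → q = p)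

/-- The finite set of pairs `(I, J)` encoding the paths with `m` steps from height `0` to height
`h` that stay nonnegative, with steps `±1` everywhere and horizontal steps only at height `0`.
The step from position `x` to position `x + 1` is recorded as `x + 1 ∈ I` when it goes up, and as
`x ∈ J` when it goes down. -/
def heightPaths : ℕ → ℕ → Finset (Finset ℕ × Finset ℕ)
  | 0, 0 => {(∅, ∅)}
  | 0, _ + 1 => ∅
  | m + 1, 0 => (heightPaths m 1).image (fun p => (p.1, insert m p.2)) ∪ heightPaths m 0
  | m + 1, h + 1 => (heightPaths m (h + 2)).image (fun p => (p.1, insert m p.2)) ∪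
      (heightPaths m h).image (fun p => (insert (m + 1) p.1, p.2))

theorem heightPaths_lt {m h : ℕ} {I J : Finset ℕ} (hp : (I, J) ∈ heightPaths m h) :
    (∀ x ∈ I, 1 ≤ x ∧ x ≤ m) ∧ (∀ x ∈ J, x < m) := by
  induction m generalizing h I J with
  | zero =>
    cases h <;> simp [heightPaths] at hp
    simp [hp]
  | succ m ih =>
    cases h with
    | zero =>
      simp only [heightPaths, Finset.mem_union, Finset.mem_image, Prod.mk.injEq, Prod.exists] at hp
      rcases hp with ⟨I', J', h', rfl, rfl⟩ | h'
      · have := ih h'; grind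
      · have := ih h'; grind
    | succ h =>
      simp only [heightPaths, Finset.mem_union, Finset.mem_image, Prod.mk.injEq, Prod.exists] at hp
      rcases hp with ⟨I', J', h', rfl, rfl⟩ | ⟨I', J', h', rfl, rfl⟩
      · have := ih h'; grind
      · have := ih h'; grind

theorem card_image_insert_snd (m h : ℕ) :
    ((heightPaths m h).image (fun p => (p.1, insert m p.2))).card = (heightPaths m h).card := by
  apply Finset.card_image_of_injOn
  rintro ⟨I, J⟩ hp ⟨I', J'⟩ hq heq
  have h1 := (heightPaths_lt hp).2
  have h2 := (heightPaths_lt hq).2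
  simp only [Prod.mk.injEq] at heq ⊢
  refine ⟨heq.1, ?_⟩
  rw [← Finset.erase_insert (fun hm => lt_irrefl m (h1 m hm)), heq.2,
    Finset.erase_insert (fun hm => lt_irrefl m (h2 m hm))]

theorem card_image_insert_fst (m h : ℕ) :
    ((heightPaths m h).image (fun p => (insert (m + 1) p.1, p.2))).card =
      (heightPaths m h).card := by
  apply Finset.card_image_of_injOn
  rintro ⟨I, J⟩ hp ⟨I', J'⟩ hq heq
  have h1 := (heightPaths_lt hp).1
  have h2 := (heightPaths_lt hq).1
  simp only [Prod.mk.injEq] at heq ⊢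
  refine ⟨?_, heq.2⟩
  rw [← Finset.erase_insert (a := m + 1) (s := I) (fun hm => by have := h1 _ hm; omega), heq.1,
    Finset.erase_insert (fun hm => by have := h2 _ hm; omega)]

theorem disjoint_image_insert_snd {m h : ℕ} {S : Finset (Finset ℕ × Finset ℕ)}
    (hS : ∀ p ∈ S, m ∉ p.2) :
    Disjoint ((heightPaths m h).image (fun p => (p.1, insert m p.2))) S := by
  rw [Finset.disjoint_left]
  intro q hq hq'
  obtain ⟨p, -, rfl⟩ := Finset.mem_image.1 hq
  exact hS _ hq' (Finset.mem_insert_self _ _)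

theorem card_heightPaths_succ_zero (m : ℕ) :
    (heightPaths (m + 1) 0).card = (heightPaths m 1).card + (heightPaths m 0).card := by
  rw [heightPaths, Finset.card_union_of_disjoint, card_image_insert_snd]
  exact disjoint_image_insert_snd fun p hp hm => lt_irrefl m ((heightPaths_lt hp).2 m hm)

theorem card_heightPaths_succ_succ (m h : ℕ) :
    (heightPaths (m + 1) (h + 1)).card =
      (heightPaths m (h + 2)).card + (heightPaths m h).card := by
  rw [heightPaths, Finset.card_union_of_disjoint, card_image_insert_snd, card_image_insert_fst]
  refine disjoint_image_insert_snd fun q hq hm => ?_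
  obtain ⟨p, hp, rfl⟩ := Finset.mem_image.1 hq
  exact lt_irrefl m ((heightPaths_lt hp).2 m hm)

theorem card_heightPaths (m h : ℕ) :
    (heightPaths m h).card = if h ≤ m then m.choose ((m - h) / 2) else 0 := by
  induction m generalizing h with
  | zero => cases h <;> simp [heightPaths]
  | succ m ih =>
    cases h with
    | zero =>
      rw [card_heightPaths_succ_zero, ih, ih]
      obtain ⟨k, rfl | rfl⟩ : ∃ k, m = 2 * k ∨ m = 2 * k + 1 := ⟨m / 2, by omega⟩
      · cases k with
        | zero => simp
        | succ k =>
          rw [if_pos (by omega), if_pos (by omega), if_pos (by omega),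
            show (2 * (k + 1) - 1) / 2 = k by omega, show (2 * (k + 1) - 0) / 2 = k + 1 by omega,
            show (2 * (k + 1) + 1 - 0) / 2 = k + 1 by omega, Nat.choose_succ_succ]
      · rw [if_pos (by omega), if_pos (by omega), if_pos (by omega),
          show (2 * k + 1 - 1) / 2 = k by omega, show (2 * k + 1 - 0) / 2 = k by omega,
          show (2 * k + 1 + 1 - 0) / 2 = k + 1 by omega, Nat.choose_succ_succ,
          Nat.choose_symm_half]
    | succ h =>
      rw [card_heightPaths_succ_succ, ih, ih]
      by_cases h2 : h + 2 ≤ m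
      · rw [if_pos h2, if_pos (by omega), if_pos (by omega),
          show (m + 1 - (h + 1)) / 2 = (m - (h + 2)) / 2 + 1 by omega,
          show (m - h) / 2 = (m - (h + 2)) / 2 + 1 by omega, Nat.choose_succ_succ]
      · rw [if_neg h2]
        by_cases h3 : h ≤ m
        · rw [if_pos h3, if_pos (by omega), show (m + 1 - (h + 1)) / 2 = 0 by omega,
            show (m - h) / 2 = 0 by omega]
          simp
        · rw [if_neg h3, if_neg (by omega)]

theorem heightPaths_spec {m h : ℕ} {I J : Finset ℕ} (hp : (I, J) ∈ heightPaths m h) :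
    I.card = J.card + h ∧
      ∀ x < m, (J.filter (· ≤ x)).card ≤ (I.filter (· ≤ x)).card ∧ ¬ (x ∈ J ∧ x + 1 ∈ I) ∧
        (x ∉ J → x + 1 ∉ I → (J.filter (· ≤ x)).card = (I.filter (· ≤ x)).card) := by
  induction m generalizing h I J with
  | zero =>
    cases h <;> simp [heightPaths] at hp
    simp [hp]
  | succ m ih =>
    have key : ∀ I J : Finset ℕ, (∀ x ∈ I, 1 ≤ x ∧ x ≤ m) → (∀ x ∈ J, x < m) →
        I.filter (· ≤ m) = I ∧ J.filter (· ≤ m) = J ∧ (insert m J).filter (· ≤ m) = insert m J ∧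
        (insert (m + 1) I).filter (· ≤ m) = I ∧
        (insert m J).card = J.card + 1 ∧ (insert (m + 1) I).card = I.card + 1 ∧
        ∀ x < m, (insert m J).filter (· ≤ x) = J.filter (· ≤ x) ∧
          (insert (m + 1) I).filter (· ≤ x) = I.filter (· ≤ x) := by
      intro I J hI hJ
      refine ⟨by grind, by grind, by grind, by grind, by grind, by grind, by grind⟩
    cases h with
    | zero =>
      simp only [heightPaths, Finset.mem_union, Finset.mem_image, Prod.mk.injEq, Prod.exists] at hp
      rcases hp with ⟨I', J', h', rfl, rfl⟩ | h'
      · have a := heightPaths_lt h'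
        obtain ⟨k1, k2, k3, k4, k5, k6, k7⟩ := key _ _ a.1 a.2
        obtain ⟨hc, hx⟩ := ih h'
        refine ⟨by omega, fun x hxm => ?_⟩
        rcases Nat.lt_succ_iff_lt_or_eq.1 hxm with hlt | rfl
        · have := hx x hlt; have := k7 x hlt; grind
        · grind
      · have a := heightPaths_lt h'
        obtain ⟨k1, k2, k3, k4, k5, k6, k7⟩ := key _ _ a.1 a.2
        obtain ⟨hc, hx⟩ := ih h'
        refine ⟨by omega, fun x hxm => ?_⟩
        rcases Nat.lt_succ_iff_lt_or_eq.1 hxm with hlt | rfl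
        · exact hx x hlt
        · grind
    | succ h =>
      simp only [heightPaths, Finset.mem_union, Finset.mem_image, Prod.mk.injEq, Prod.exists] at hp
      rcases hp with ⟨I', J', h', rfl, rfl⟩ | ⟨I', J', h', rfl, rfl⟩
      · have a := heightPaths_lt h'
        obtain ⟨k1, k2, k3, k4, k5, k6, k7⟩ := key _ _ a.1 a.2
        obtain ⟨hc, hx⟩ := ih h'
        refine ⟨by omega, fun x hxm => ?_⟩
        rcases Nat.lt_succ_iff_lt_or_eq.1 hxm with hlt | rfl
        · have := hx x hlt; have := k7 x hlt; grind
        · grind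
      · have a := heightPaths_lt h'
        obtain ⟨k1, k2, k3, k4, k5, k6, k7⟩ := key _ _ a.1 a.2
        obtain ⟨hc, hx⟩ := ih h'
        refine ⟨by omega, fun x hxm => ?_⟩
        rcases Nat.lt_succ_iff_lt_or_eq.1 hxm with hlt | rfl
        · have := hx x hlt; have := k7 x hlt; grind
        · grind

/-- A set of pairs on which the orders of the first and of the second coordinates agree. -/
def IsMonotonePairing (S : Finset (ℕ × ℕ)) : Prop :=
  ∀ p ∈ S, ∀ q ∈ S, p.1 < q.1 ↔ p.2 < q.2

namespace IsMonotonePairing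

variable {S T : Finset (ℕ × ℕ)}

theorem fst_injOn (hS : IsMonotonePairing S) : Set.InjOn Prod.fst (S : Set (ℕ × ℕ)) := by
  intro p hp q hq h
  have := hS p hp q hq
  have := hS q hq p hp
  ext <;> grind

theorem snd_injOn (hS : IsMonotonePairing S) : Set.InjOn Prod.snd (S : Set (ℕ × ℕ)) := by
  intro p hp q hq h
  have := hS p hp q hq
  have := hS q hq p hp
  ext <;> grind

theorem card_filter_fst (hS : IsMonotonePairing S) (P : ℕ → Prop) [DecidablePred P] :
    ((S.image Prod.fst).filter P).card = (S.filter (fun p => P p.1)).card := by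
  rw [Finset.filter_image]
  exact Finset.card_image_of_injOn (hS.fst_injOn.mono (Finset.filter_subset _ _))

theorem card_filter_snd (hS : IsMonotonePairing S) (P : ℕ → Prop) [DecidablePred P] :
    ((S.image Prod.snd).filter P).card = (S.filter (fun p => P p.2)).card := by
  rw [Finset.filter_image]
  exact Finset.card_image_of_injOn (hS.snd_injOn.mono (Finset.filter_subset _ _))

theorem card_image_eq (hS : IsMonotonePairing S) :
    (S.image Prod.fst).card = (S.image Prod.snd).card := by
  rw [Finset.card_image_of_injOn hS.fst_injOn, Finset.card_image_of_injOn hS.snd_injOn]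

theorem rank_eq (hS : IsMonotonePairing S) {p : ℕ × ℕ} (hp : p ∈ S) :
    ((S.image Prod.fst).filter (· ≤ p.1)).card = ((S.image Prod.snd).filter (· ≤ p.2)).card := by
  rw [hS.card_filter_fst, hS.card_filter_snd]
  congr 1
  refine Finset.filter_congr fun q hq => ?_
  have := hS p hp q hq
  omega

theorem subset_of_image_eq (hS : IsMonotonePairing S) (hT : IsMonotonePairing T)
    (h1 : S.image Prod.fst = T.image Prod.fst) (h2 : S.image Prod.snd = T.image Prod.snd) :
    S ⊆ T := by
  intro p hp
  have hp1 : p.1 ∈ T.image Prod.fst := h1 ▸ Finset.mem_image_of_mem _ hp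
  obtain ⟨q, hq, hqp⟩ := Finset.mem_image.1 hp1
  have hr := hS.rank_eq hp
  have hr' := hT.rank_eq hq
  rw [h1, h2, ← hqp, hr'] at hr
  have hp2 : p.2 ∈ T.image Prod.snd := h2 ▸ Finset.mem_image_of_mem _ hp
  have hq2 : q.2 ∈ T.image Prod.snd := Finset.mem_image_of_mem _ hq
  have hsnd : q.2 = p.2 := by
    have aux : ∀ a b, a < b → b ∈ T.image Prod.snd →
        ((T.image Prod.snd).filter (· ≤ a)).card < ((T.image Prod.snd).filter (· ≤ b)).card := by
      intro a b hab hb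
      apply Finset.card_lt_card
      rw [Finset.ssubset_iff_of_subset]
      · exact ⟨b, by simpa using hb, by simp [hab]⟩
      · exact Finset.monotone_filter_right _ fun x _ hx => le_trans hx hab.le
    rcases lt_trichotomy q.2 p.2 with h | h | h
    · have := aux _ _ h hp2; omega
    · exact h
    · have := aux _ _ h hq2; omega
  have : q = p := Prod.ext hqp hsnd
  exact this ▸ hq

theorem eq_of_image_eq (hS : IsMonotonePairing S) (hT : IsMonotonePairing T)
    (h1 : S.image Prod.fst = T.image Prod.fst) (h2 : S.image Prod.snd = T.image Prod.snd) :
    S = T :=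
  (hS.subset_of_image_eq hT h1 h2).antisymm (hT.subset_of_image_eq hS h1.symm h2.symm)

end IsMonotonePairing

/-- The pairing of two finite sets in increasing order. -/
def sortedPairing (I J : Finset ℕ) : Finset (ℕ × ℕ) :=
  (List.zip (I.sort (· ≤ ·)) (J.sort (· ≤ ·))).toFinset

theorem isMonotonePairing_sortedPairing (I J : Finset ℕ) :
    IsMonotonePairing (sortedPairing I J) := by
  intro p hp q hq
  simp only [sortedPairing, List.mem_toFinset] at hp hq
  obtain ⟨a, ha, rfl⟩ := List.mem_iff_getElem.1 hp
  obtain ⟨b, hb, rfl⟩ := List.mem_iff_getElem.1 hq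
  simp only [List.getElem_zip]
  have hI := (I.sortedLT_sort).strictMono_get
  have hJ := (J.sortedLT_sort).strictMono_get
  simp only [List.length_zip, lt_min_iff] at ha hb
  have e1 := hI.lt_iff_lt (a := ⟨a, ha.1⟩) (b := ⟨b, hb.1⟩)
  have e2 := hJ.lt_iff_lt (a := ⟨a, ha.2⟩) (b := ⟨b, hb.2⟩)
  simp only [List.get_eq_getElem, Fin.mk_lt_mk] at e1 e2
  rw [e1, e2]

theorem image_fst_sortedPairing {I J : Finset ℕ} (h : I.card = J.card) :
    (sortedPairing I J).image Prod.fst = I := by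
  ext x
  rw [← Finset.mem_sort (s := I) (· ≤ ·), ← List.map_fst_zip (l₁ := I.sort (· ≤ ·))
    (l₂ := J.sort (· ≤ ·)) (by simp [h])]
  simp [sortedPairing]

theorem image_snd_sortedPairing {I J : Finset ℕ} (h : I.card = J.card) :
    (sortedPairing I J).image Prod.snd = J := by
  ext x
  rw [← Finset.mem_sort (s := J) (· ≤ ·), ← List.map_snd_zip (l₁ := I.sort (· ≤ ·))
    (l₂ := J.sort (· ≤ ·)) (by simp [h])]
  simp [sortedPairing]

theorem IsAntichainAn.isMonotonePairing {n : ℕ} {A : Finset (ℕ × ℕ)} (hA : IsAntichainAn n A) :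
    IsMonotonePairing A := by
  intro p hp q hq
  have h1 := hA.2 p hp q hq
  have h2 := hA.2 q hq p hp
  by_cases h : p = q
  · simp [h]
  · have h1 := h1 h
    have h2 := h2 (Ne.symm h)
    simp only [AnLe] at h1 h2
    omega

theorem mem_AnUniv {n : ℕ} {p : ℕ × ℕ} : p ∈ AnUniv n ↔ AnMem n p := by
  simp only [AnUniv, AnMem, Finset.mem_filter, Finset.mem_product, Finset.mem_Icc]
  omega

theorem mem_rowA {n : ℕ} {A : Finset (ℕ × ℕ)} {p : ℕ × ℕ} :
    p ∈ rowA n A ↔ (AnMem n p ∧ ∀ q ∈ A, ¬ AnLe p q) ∧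
      ∀ q, AnMem n q → (∀ r ∈ A, ¬ AnLe q r) → AnLe q p → q = p := by
  simp only [rowA, Finset.mem_filter, mem_AnUniv, and_imp]

theorem isAntichainAn_rowA (n : ℕ) (A : Finset (ℕ × ℕ)) : IsAntichainAn n (rowA n A) := by
  refine ⟨fun p hp => (mem_rowA.1 hp).1.1, fun p hp q hq hne hle => hne ?_⟩
  exact (mem_rowA.1 hq).2 p (mem_rowA.1 hp).1.1 (mem_rowA.1 hp).1.2 hle

theorem singleton_mem_rowA {n : ℕ} {A : Finset (ℕ × ℕ)} {x : ℕ} (hx : 1 ≤ x) (hxn : x ≤ n)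
    (hU : ∀ q ∈ A, ¬ AnLe (x, x) q) : (x, x) ∈ rowA n A := by
  refine mem_rowA.2 ⟨⟨⟨hx, le_rfl, hxn⟩, hU⟩, ?_⟩
  rintro ⟨a, b⟩ ⟨-, h1, -⟩ - ⟨h2, h3⟩
  simp only [Prod.mk.injEq] at *
  omega

theorem mem_image_fst_rowA {n : ℕ} {A : Finset (ℕ × ℕ)} (hA : IsAntichainAn n A) {x : ℕ}
    (hx : 1 ≤ x) (hxn : x ≤ n) :
    x ∈ (rowA n A).image Prod.fst ↔
      x + 1 ∈ A.image Prod.fst ∨ ∀ q ∈ A, ¬ AnLe (x, x) q := by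
  constructor
  · intro h
    obtain ⟨⟨a, y⟩, hp, rfl⟩ := Finset.mem_image.1 h
    obtain ⟨⟨⟨-, hay, hyn⟩, hno⟩, hmin⟩ := mem_rowA.1 hp
    simp only at *
    rcases hay.eq_or_lt with rfl | hlt
    · exact Or.inr hno
    · left
      by_contra hc
      have := hmin (a + 1, y) ⟨by simp, hlt, hyn⟩ ?_ ⟨by simp, le_rfl⟩
      · simp at this
      · rintro ⟨i, j⟩ hr ⟨h1, h2⟩
        refine hno _ hr ⟨?_, h2⟩
        have : i ≠ a + 1 := fun hi => hc (Finset.mem_image.2 ⟨_, hr, hi⟩)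
        simp only at *
        omega
  · rintro (h | h)
    · obtain ⟨⟨i, j⟩, hp, hi⟩ := Finset.mem_image.1 h
      obtain rfl : i = x + 1 := hi
      obtain ⟨-, hij, hjn⟩ := hA.1 _ hp
      simp only at hij hjn
      have hex : ∃ y, x ≤ y ∧ ∀ q ∈ A, ¬ AnLe (x, y) q := by
        refine ⟨j, by omega, fun q hq hle => ?_⟩
        refine hA.2 _ hp q hq ?_ ⟨Nat.le_succ_of_le hle.1, hle.2⟩
        rintro rfl
        have := hle.1
        simp at this
      classical
      obtain ⟨hxy, hno⟩ := Nat.find_spec hex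
      have hyj : Nat.find hex ≤ j := by
        refine Nat.find_min' hex ⟨by omega, fun q hq hle => ?_⟩
        refine hA.2 _ hp q hq ?_ ⟨Nat.le_succ_of_le hle.1, hle.2⟩
        rintro rfl
        have := hle.1
        simp at this
      refine Finset.mem_image.2 ⟨(x, Nat.find hex),
        mem_rowA.2 ⟨⟨⟨hx, hxy, by simp only; omega⟩, hno⟩,
        ?_⟩, rfl⟩
      rintro ⟨a, b⟩ ⟨ha, hab, hb⟩ hno' ⟨h1, h2⟩
      dsimp only at hab h1 h2
      rcases h1.eq_or_lt with rfl | hlt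
      · have := Nat.find_min' hex ⟨hab, hno'⟩
        exact Prod.ext rfl (le_antisymm h2 this)
      · exact absurd ⟨hlt, h2.trans hyj⟩ (hno' _ hp)
    · exact Finset.mem_image.2 ⟨_, singleton_mem_rowA hx hxn h, rfl⟩

theorem mem_image_snd_rowA {n : ℕ} {A : Finset (ℕ × ℕ)} (hA : IsAntichainAn n A) {y : ℕ}
    (hy : 1 ≤ y) (hyn : y ≤ n) :
    y ∈ (rowA n A).image Prod.snd ↔
      y - 1 ∈ A.image Prod.snd ∨ ∀ q ∈ A, ¬ AnLe (y, y) q := by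
  constructor
  · intro h
    obtain ⟨⟨a, b⟩, hp, rfl⟩ := Finset.mem_image.1 h
    obtain ⟨⟨⟨ha, hab, hbn⟩, hno⟩, hmin⟩ := mem_rowA.1 hp
    simp only at *
    rcases hab.eq_or_lt with rfl | hlt
    · exact Or.inr hno
    · left
      by_contra hc
      have := hmin (a, b - 1) ⟨ha, by simp only; omega, by simp only; omega⟩ ?_
        ⟨le_rfl, by simp only; omega⟩
      · simp only [Prod.mk.injEq] at this
        omega
      · rintro ⟨i, j⟩ hr ⟨h1, h2⟩
        refine hno _ hr ⟨h1, ?_⟩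
        have : j ≠ b - 1 := fun hi => hc (Finset.mem_image.2 ⟨_, hr, hi⟩)
        simp only at *
        omega
  · rintro (h | h)
    · obtain ⟨⟨i, j⟩, hp, hj⟩ := Finset.mem_image.1 h
      obtain rfl : j = y - 1 := hj
      obtain ⟨hi, hij, hjn⟩ := hA.1 _ hp
      simp only at hi hij hjn
      have hi' : i ≤ y ∧ ∀ q ∈ A, ¬ AnLe (i, y) q := by
        refine ⟨by omega, fun q hq hle => ?_⟩
        refine hA.2 _ hp q hq ?_ ⟨hle.1, (Nat.sub_le _ _).trans hle.2⟩
        rintro rfl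
        have := hle.2
        simp only at this
        omega
      have hgr := Nat.findGreatest_spec (P := fun x => ∀ q ∈ A, ¬ AnLe (x, y) q) hi'.1 hi'.2
      have hge := Nat.le_findGreatest (P := fun x => ∀ q ∈ A, ¬ AnLe (x, y) q) hi'.1 hi'.2
      have hle := Nat.findGreatest_le (P := fun x => ∀ q ∈ A, ¬ AnLe (x, y) q) y
      have hmax : ∀ k, k ≤ y → (∀ q ∈ A, ¬ AnLe (k, y) q) →
          k ≤ Nat.findGreatest (fun x => ∀ q ∈ A, ¬ AnLe (x, y) q) y :=
        fun k hk h => Nat.le_findGreatest hk h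
      generalize Nat.findGreatest (fun x => ∀ q ∈ A, ¬ AnLe (x, y) q) y = x at *
      refine Finset.mem_image.2 ⟨(x, y),
        mem_rowA.2 ⟨⟨⟨by simp only; omega, hle, hyn⟩, hgr⟩, ?_⟩, rfl⟩
      rintro ⟨a, b⟩ ⟨ha, hab, hb⟩ hno' ⟨h1, h2⟩
      dsimp only at hab h1 h2
      rcases h2.eq_or_lt with rfl | hlt
      · exact Prod.ext (le_antisymm (hmax a hab hno') h1) rfl
      · exact absurd ⟨hge.trans h1, by simp only; omega⟩ (hno' _ hp)
    · exact Finset.mem_image.2 ⟨_, singleton_mem_rowA hy hyn h, rfl⟩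

theorem LK_eq_iff {n : ℕ} {A B : Finset (ℕ × ℕ)} (hA : IsAntichainAn n A)
    (hB : IsAntichainAn n B) :
    LK n B = A ↔ A.image Prod.fst = Finset.Icc 1 n \ B.image Prod.snd ∧
      A.image Prod.snd = Finset.Icc 1 n \ B.image Prod.fst := by
  have hLK : LK n B = sortedPairing (Finset.Icc 1 n \ B.image Prod.snd)
      (Finset.Icc 1 n \ B.image Prod.fst) := rfl
  have hcard : (Finset.Icc 1 n \ B.image Prod.snd).card =
      (Finset.Icc 1 n \ B.image Prod.fst).card := by
    rw [Finset.card_sdiff_of_subset, Finset.card_sdiff_of_subset,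
      hB.isMonotonePairing.card_image_eq]
    all_goals
      intro x hx
      obtain ⟨p, hp, rfl⟩ := Finset.mem_image.1 hx
      obtain ⟨h1, h2, h3⟩ := hB.1 p hp
      rw [Finset.mem_Icc]
      omega
  constructor
  · rintro rfl
    exact ⟨image_fst_sortedPairing hcard, image_snd_sortedPairing hcard⟩
  · rintro ⟨h1, h2⟩
    refine (isMonotonePairing_sortedPairing _ _).eq_of_image_eq hA.isMonotonePairing ?_ ?_
    · rw [image_fst_sortedPairing hcard, h1]
    · rw [image_snd_sortedPairing hcard, h2]

theorem LK_rowA_eq_iff {n : ℕ} {A : Finset (ℕ × ℕ)} (hA : IsAntichainAn n A) :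
    LK n (rowA n A) = A ↔ ∀ x, 1 ≤ x → x ≤ n →
      (x ∈ A.image Prod.fst ↔
        ¬ (x - 1 ∈ A.image Prod.snd ∨ ∀ q ∈ A, ¬ AnLe (x, x) q)) ∧
      (x ∈ A.image Prod.snd ↔
        ¬ (x + 1 ∈ A.image Prod.fst ∨ ∀ q ∈ A, ¬ AnLe (x, x) q)) := by
  rw [LK_eq_iff hA (isAntichainAn_rowA n A)]
  have hsub : ∀ x, x ∈ A.image Prod.fst ∨ x ∈ A.image Prod.snd → 1 ≤ x ∧ x ≤ n := by
    rintro x (hx | hx)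
    all_goals
      obtain ⟨p, hp, rfl⟩ := Finset.mem_image.1 hx
      obtain ⟨h1, h2, h3⟩ := hA.1 p hp
      omega
  constructor
  · rintro ⟨h1, h2⟩ x hx hxn
    rw [← mem_image_fst_rowA hA hx hxn, ← mem_image_snd_rowA hA hx hxn]
    have e1 := Finset.ext_iff.1 h1 x
    have e2 := Finset.ext_iff.1 h2 x
    rw [Finset.mem_sdiff, Finset.mem_Icc, and_iff_right ⟨hx, hxn⟩] at e1 e2
    exact ⟨e1, e2⟩
  · intro h
    constructor <;> ext x <;> rw [Finset.mem_sdiff, Finset.mem_Icc]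
    · by_cases hx : 1 ≤ x ∧ x ≤ n
      · rw [(h x hx.1 hx.2).1, ← mem_image_snd_rowA hA hx.1 hx.2, and_iff_right hx]
      · exact iff_of_false (fun hm => hx (hsub x (Or.inl hm))) fun hm => hx hm.1
    · by_cases hx : 1 ≤ x ∧ x ≤ n
      · rw [(h x hx.1 hx.2).2, ← mem_image_fst_rowA hA hx.1 hx.2, and_iff_right hx]
      · exact iff_of_false (fun hm => hx (hsub x (Or.inr hm))) fun hm => hx hm.1

theorem filter_le_succ (I : Finset ℕ) (m : ℕ) :
    I.filter (· ≤ m + 1) =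
      if m + 1 ∈ I then insert (m + 1) (I.filter (· ≤ m)) else I.filter (· ≤ m) := by
  grind

theorem filter_lt_succ (J : Finset ℕ) (m : ℕ) :
    J.filter (· < m + 1) = if m ∈ J then insert m (J.filter (· < m)) else J.filter (· < m) := by
  grind

theorem image_mem_heightPaths {n : ℕ} {A : Finset (ℕ × ℕ)} (hA : IsAntichainAn n A)
    (hfix : LK n (rowA n A) = A) :
    (A.image Prod.fst, A.image Prod.snd) ∈ heightPaths (n + 1) 0 := by
  rw [LK_rowA_eq_iff hA] at hfix
  have hM := hA.isMonotonePairing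
  have hI : ∀ x ∈ A.image Prod.fst, 1 ≤ x ∧ x ≤ n := by
    intro x hx
    obtain ⟨p, hp, rfl⟩ := Finset.mem_image.1 hx
    obtain ⟨h1, h2, h3⟩ := hA.1 p hp
    omega
  have hJ : ∀ x ∈ A.image Prod.snd, 1 ≤ x ∧ x ≤ n := by
    intro x hx
    obtain ⟨p, hp, rfl⟩ := Finset.mem_image.1 hx
    obtain ⟨h1, h2, h3⟩ := hA.1 p hp
    omega
  have hballot : ∀ m, ((A.image Prod.snd).filter (· < m)).card ≤
      ((A.image Prod.fst).filter (· ≤ m)).card := by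
    intro m
    rw [hM.card_filter_fst, hM.card_filter_snd]
    refine Finset.card_le_card fun p hp => ?_
    rw [Finset.mem_filter] at hp ⊢
    obtain ⟨h1, h2, h3⟩ := hA.1 p hp.1
    exact ⟨hp.1, by omega⟩
  have hflat : ∀ m, (∀ q ∈ A, ¬ AnLe (m, m) q) → ((A.image Prod.fst).filter (· ≤ m)).card ≤
      ((A.image Prod.snd).filter (· < m)).card := by
    intro m hm
    rw [hM.card_filter_fst, hM.card_filter_snd]
    refine Finset.card_le_card fun p hp => ?_
    rw [Finset.mem_filter] at hp ⊢
    have := hm p hp.1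
    simp only [AnLe] at this
    exact ⟨hp.1, by omega⟩
  have main : ∀ m ≤ n + 1, ∀ h, ((A.image Prod.fst).filter (· ≤ m)).card =
      ((A.image Prod.snd).filter (· < m)).card + h →
      ((A.image Prod.fst).filter (· ≤ m), (A.image Prod.snd).filter (· < m)) ∈
        heightPaths m h := by
    have hcard := hM.card_image_eq
    generalize hIdef : A.image Prod.fst = I at *
    generalize hJdef : A.image Prod.snd = J at *
    intro m
    induction m with
    | zero =>
      intro _ h hh
      have e1 : I.filter (· ≤ 0) = ∅ := by grind
      have e2 : J.filter (· < 0) = ∅ := by grind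
      rw [e1, e2] at hh ⊢
      obtain rfl : h = 0 := by simpa using hh.symm
      simp [heightPaths]
    | succ m ih =>
      intro hm h hh
      have ih := ih (by omega)
      have hb := hballot m
      by_cases h1 : m + 1 ∈ I
      · have e1 : I.filter (· ≤ m + 1) = insert (m + 1) (I.filter (· ≤ m)) := by
          rw [filter_le_succ, if_pos h1]
        have c1 : (I.filter (· ≤ m + 1)).card = (I.filter (· ≤ m)).card + 1 := by
          rw [e1, Finset.card_insert_of_notMem (by simp)]
        have h2 : m ∉ J := by
          have := (hfix (m + 1) (by omega) (hI _ h1).2).1.1 h1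
          intro hmJ
          exact this (Or.inl hmJ)
        have e2 : J.filter (· < m + 1) = J.filter (· < m) := by rw [filter_lt_succ, if_neg h2]
        rw [e2] at hh
        obtain ⟨h, rfl⟩ : ∃ k, h = k + 1 := ⟨h - 1, by omega⟩
        rw [e1, e2, heightPaths]
        exact Finset.mem_union_right _ (Finset.mem_image_of_mem
          (fun p => (insert (m + 1) p.1, p.2)) (ih h (by omega)))
      · have e1 : I.filter (· ≤ m + 1) = I.filter (· ≤ m) := by rw [filter_le_succ, if_neg h1]
        rw [e1] at hh ⊢
        by_cases h2 : m ∈ J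
        · have e2 : J.filter (· < m + 1) = insert m (J.filter (· < m)) := by
            rw [filter_lt_succ, if_pos h2]
          have c2 : (J.filter (· < m + 1)).card = (J.filter (· < m)).card + 1 := by
            rw [e2, Finset.card_insert_of_notMem (by simp)]
          have := Finset.mem_image_of_mem (fun p => (p.1, insert m p.2)) (ih (h + 1) (by omega))
          rw [e2]
          cases h <;> exact Finset.mem_union_left _ this
        · have e2 : J.filter (· < m + 1) = J.filter (· < m) := by rw [filter_lt_succ, if_neg h2]
          rw [e2] at hh ⊢
          have hf : (I.filter (· ≤ m)).card ≤ (J.filter (· < m)).card := by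
            apply hflat
            rcases Nat.eq_zero_or_pos m with rfl | hpos
            · intro q hq hle
              have := (hA.1 q hq).1
              have := hle.1
              simp only at this
              omega
            · by_contra hU
              exact h2 ((hfix m hpos (by omega)).2.2 fun h => h.elim h1 hU)
          obtain rfl : h = 0 := by omega
          exact Finset.mem_union_right _ (ih 0 hh)
  have e1 : (A.image Prod.fst).filter (· ≤ n + 1) = A.image Prod.fst :=
    Finset.filter_true_of_mem fun x hx => by have := hI x hx; omega
  have e2 : (A.image Prod.snd).filter (· < n + 1) = A.image Prod.snd :=
    Finset.filter_true_of_mem fun x hx => by have := hJ x hx; omega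
  have := main (n + 1) le_rfl 0
  rw [e1, e2] at this
  exact this hM.card_image_eq

theorem exists_fixed_of_mem_heightPaths {n : ℕ} {I J : Finset ℕ}
    (hp : (I, J) ∈ heightPaths (n + 1) 0) :
    ∃ A, IsAntichainAn n A ∧ LK n (rowA n A) = A ∧ A.image Prod.fst = I ∧
      A.image Prod.snd = J := by
  obtain ⟨hI, hJ⟩ := heightPaths_lt hp
  obtain ⟨hcard, hx⟩ := heightPaths_spec hp
  have hM := isMonotonePairing_sortedPairing I J
  have hfst := image_fst_sortedPairing (I := I) (J := J) hcard
  have hsnd := image_snd_sortedPairing (I := I) (J := J) hcard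
  generalize sortedPairing I J = A at *
  have hle : ∀ p ∈ A, p.1 ≤ p.2 := by
    intro p hp
    by_contra! hlt
    have hr := hM.rank_eq hp
    have hp1 : p.1 ∈ I := hfst ▸ Finset.mem_image_of_mem _ hp
    have hp2 : p.2 ∈ J := hsnd ▸ Finset.mem_image_of_mem _ hp
    have hb := (hx p.2 (hJ _ hp2)).1
    rw [hfst, hsnd] at hr
    have : (I.filter (· ≤ p.2)).card < (I.filter (· ≤ p.1)).card := by
      apply Finset.card_lt_card
      rw [Finset.ssubset_iff_of_subset]
      · exact ⟨p.1, by simpa using hp1, by simp [hlt]⟩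
      · exact Finset.monotone_filter_right _ fun x _ hx => le_trans hx hlt.le
    omega
  have hA : IsAntichainAn n A := by
    refine ⟨fun p hp => ?_, fun p hp q hq hne hpq => hne ?_⟩
    · have hp1 : p.1 ∈ I := hfst ▸ Finset.mem_image_of_mem _ hp
      have hp2 : p.2 ∈ J := hsnd ▸ Finset.mem_image_of_mem _ hp
      exact ⟨(hI _ hp1).1, hle p hp, Nat.lt_succ_iff.1 (hJ _ hp2)⟩
    · have h1 := hM p hp q hq
      have h2 := hM q hq p hp
      obtain ⟨h3, h4⟩ := hpq
      ext <;> omega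
  have hgap : ∀ x, (J.filter (· ≤ x)).card = (I.filter (· ≤ x)).card →
      ∀ p ∈ A, p.1 ≤ x → p.2 ≤ x := by
    intro x hxc p hp hpx
    rw [← hfst, ← hsnd, hM.card_filter_fst, hM.card_filter_snd] at hxc
    have hsub : A.filter (fun p => p.2 ≤ x) ⊆ A.filter (fun p => p.1 ≤ x) :=
      Finset.monotone_filter_right A fun p hp hpx => (hle p hp).trans hpx
    have heq := Finset.eq_of_subset_of_card_le hsub hxc.ge
    have : p ∈ A.filter (fun p => p.2 ≤ x) := heq ▸ Finset.mem_filter.2 ⟨hp, hpx⟩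
    exact (Finset.mem_filter.1 this).2
  refine ⟨A, hA, (LK_rowA_eq_iff hA).2 fun x hx1 hxn => ?_, hfst, hsnd⟩
  have hcovI : x ∈ I → ¬ ∀ q ∈ A, ¬ AnLe (x, x) q := by
    intro h hU
    rw [← hfst] at h
    obtain ⟨p, hp, rfl⟩ := Finset.mem_image.1 h
    exact hU p hp ⟨le_rfl, hle p hp⟩
  have hcovJ : x ∈ J → ¬ ∀ q ∈ A, ¬ AnLe (x, x) q := by
    intro h hU
    rw [← hsnd] at h
    obtain ⟨p, hp, rfl⟩ := Finset.mem_image.1 h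
    exact hU p hp ⟨hle p hp, le_rfl⟩
  have hx0 := (hx (x - 1) (by omega)).2
  have hx1' := (hx x (by omega)).2
  rw [Nat.sub_add_cancel hx1] at hx0
  have hflat0 : x ∉ I → x - 1 ∉ J → ∀ q ∈ A, ¬ AnLe (x, x) q := by
    rintro h1 h2 q hq ⟨h3, h4⟩
    have hne : q.1 ≠ x := fun h => h1 (h ▸ hfst ▸ Finset.mem_image_of_mem _ hq)
    have := hgap (x - 1) (hx0.2 h2 h1) q hq
    simp only at h3 h4
    omega
  have hflat1 : x ∉ J → x + 1 ∉ I → ∀ q ∈ A, ¬ AnLe (x, x) q := by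
    rintro h1 h2 q hq ⟨h3, h4⟩
    have hne : q.2 ≠ x := fun h => h1 (h ▸ hsnd ▸ Finset.mem_image_of_mem _ hq)
    have := hgap x (hx1'.2 h1 h2) q hq
    simp only at h3 h4
    omega
  rw [hfst, hsnd]
  refine ⟨⟨fun h => ?_, fun h => ?_⟩, ⟨fun h => ?_, fun h => ?_⟩⟩
  · rintro (h' | h')
    · exact hx0.1 ⟨h', h⟩
    · exact hcovI h h'
  · by_contra h'
    exact h (or_iff_not_imp_left.2 (hflat0 h'))
  · rintro (h' | h')
    · exact hx1'.1 ⟨h, h'⟩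
    · exact hcovJ h h'
  · by_contra h'
    exact h (or_iff_not_imp_left.2 (hflat1 h'))

/-- For every `n ≥ 1`, the number of antichains `A` of `Aⁿ` satisfying
`LK (Row_A A) = A` equals the central binomial coefficient `C(n+1, ⌊(n+1)/2⌋)`. -/
theorem stmt17 (n : ℕ) (hn : 1 ≤ n) :
    ((AnUniv n).powerset.filter
        (fun A => IsAntichainAn n A ∧ LK n (rowA n A) = A)).card
      = Nat.choose (n + 1) ((n + 1) / 2) := by
  have himage : heightPaths (n + 1) 0 =
      ((AnUniv n).powerset.filter (fun A => IsAntichainAn n A ∧ LK n (rowA n A) = A)).image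
        (fun A => (A.image Prod.fst, A.image Prod.snd)) := by
    ext ⟨I, J⟩
    simp only [Finset.mem_image, Finset.mem_filter, Finset.mem_powerset, Prod.mk.injEq]
    constructor
    · intro h
      obtain ⟨A, hA, hfix, h1, h2⟩ := exists_fixed_of_mem_heightPaths h
      exact ⟨A, ⟨fun p hp => mem_AnUniv.2 (hA.1 p hp), hA, hfix⟩, h1, h2⟩
    · rintro ⟨A, ⟨-, hA, hfix⟩, rfl, rfl⟩
      exact image_mem_heightPaths hA hfix
  have hcard := card_heightPaths (n + 1) 0
  rw [himage, Finset.card_image_of_injOn] at hcard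
  · simpa using hcard
  · intro A hA B hB h
    simp only [Finset.coe_filter, Set.mem_ofPred_eq] at hA hB
    simp only [Prod.mk.injEq] at h
    exact hA.2.1.isMonotonePairing.eq_of_image_eq hB.2.1.isMonotonePairing h.1 h.2
end

section
/- Let P be a graded poset of rank r, let F be an order filter of P, and let p ∈ P be an element of rank i. Then p ∈ Rvac_F(F) if and only if p ∈ Row_F^{i+1}(F). -/
open scoped Classical

noncomputable section

variable {P : Type} [Fintype P] [PartialOrder P]

/-- `F` is an order filter of `P`. -/
def IsOF (F : Finset P) : Prop := ∀ x ∈ F, ∀ y, x ≤ y → y ∈ F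

/-- The order filter rank toggle `𝐭_i`, in simultaneous form (it agrees with the
composition of the pairwise commuting order filter toggles `t_p` over the elements `p` of
rank `i`): an element `p` of rank `i` belongs to the image iff either `p ∉ F` and
`F ∪ {p}` is an order filter, or `p ∈ F` and `F \ {p}` is not an order filter; membership
of elements of other ranks is unchanged. -/
def rankToggleOF (rk : P → ℕ) (i : ℕ) (F : Finset P) : Finset P :=
  Finset.univ.filter (fun p =>
    if rk p = i then
      (p ∉ F ∧ IsOF (insert p F)) ∨ (p ∈ F ∧ ¬ IsOF (F.erase p))
    else p ∈ F)

/-- Apply a word of rank toggles; the head of the list is applied last. -/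
def applyOF (rk : P → ℕ) : List ℕ → Finset P → Finset P
  | [], F => F
  | i :: w, F => rankToggleOF rk i (applyOF rk w F)

/-- Order filter rowmotion `Row_F = 𝐭_0 𝐭_1 ⋯ 𝐭_r`. -/
def RowOF (rk : P → ℕ) (r : ℕ) : Finset P → Finset P := applyOF rk (List.range (r + 1))

/-- The word `(𝐭_r)(𝐭_{r-1} 𝐭_r) ⋯ (𝐭_0 𝐭_1 ⋯ 𝐭_r)` for rowvacuation. -/
def rvacWordOF (r : ℕ) : List ℕ :=
  (List.range (r + 1)).foldr (fun k acc => (List.range (r + 1)).drop (r - k) ++ acc) []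

/-- Order filter rowvacuation `Rvac_F = (𝐭_r)(𝐭_{r-1} 𝐭_r) ⋯ (𝐭_0 𝐭_1 ⋯ 𝐭_r)`. -/
def RvacOF (rk : P → ℕ) (r : ℕ) : Finset P → Finset P := applyOF rk (rvacWordOF r)

end

section

variable {P : Type} [Fintype P] [PartialOrder P] {rk : P → ℕ}

theorem isOF_iff_covBy {F : Finset P} : IsOF F ↔ ∀ x ∈ F, ∀ y, x ⋖ y → y ∈ F := by
  refine ⟨fun h x hx y hxy => h x hx y hxy.le, fun h x hx y hxy => ?_⟩
  let _ : LocallyFiniteOrder P := Fintype.toLocallyFiniteOrder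
  rw [le_iff_reflTransGen_covBy] at hxy
  induction hxy with
  | refl => exact hx
  | tail _ hbc ih => exact h _ ih _ hbc

theorem isOF_insert_iff {F : Finset P} (hF : IsOF F) (p : P) :
    IsOF (insert p F) ↔ ∀ q, p ⋖ q → q ∈ F := by
  rw [isOF_iff_covBy]
  refine ⟨fun h q hq => ?_, fun h x hx y hxy => ?_⟩
  · exact Finset.mem_of_mem_insert_of_ne (h p (Finset.mem_insert_self p F) q hq) hq.ne'
  · rcases Finset.mem_insert.1 hx with rfl | hx
    · exact Finset.mem_insert_of_mem (h y hxy)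
    · exact Finset.mem_insert_of_mem (hF x hx y hxy.le)

theorem isOF_erase_iff {F : Finset P} (hF : IsOF F) (p : P) :
    IsOF (F.erase p) ↔ ∀ q, q ⋖ p → q ∉ F := by
  rw [isOF_iff_covBy]
  refine ⟨fun h q hq hqF => ?_, fun h x hx y hxy => ?_⟩
  · exact Finset.notMem_erase p F (h q (Finset.mem_erase.2 ⟨hq.ne, hqF⟩) p hq)
  · have hxF := Finset.mem_of_mem_erase hx
    refine Finset.mem_erase.2 ⟨?_, hF x hxF y hxy.le⟩
    rintro rfl
    exact h x hxy hxF

/-- Toggling an order filter at an element depends only on the neighbours of that element in the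
Hasse diagram. -/
theorem mem_rankToggleOF_iff {F : Finset P} (hF : IsOF F) (i : ℕ) (p : P) :
    p ∈ rankToggleOF rk i F ↔
      if rk p = i then (p ∉ F ∧ ∀ q, p ⋖ q → q ∈ F) ∨ (p ∈ F ∧ ∃ q, q ⋖ p ∧ q ∈ F)
      else p ∈ F := by
  simp [rankToggleOF, isOF_insert_iff hF, isOF_erase_iff hF]

theorem isOF_rankToggleOF (hcov : ∀ x y : P, x ⋖ y → rk y = rk x + 1) {F : Finset P}
    (hF : IsOF F) (i : ℕ) : IsOF (rankToggleOF rk i F) := by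
  rw [isOF_iff_covBy]
  intro x hx y hxy
  have hrk := hcov x y hxy
  rw [mem_rankToggleOF_iff hF] at hx ⊢
  have hup : x ∈ F → y ∈ F := fun h => hF x h y hxy.le
  by_cases hxi : rk x = i
  · rw [if_pos hxi] at hx
    rw [if_neg (by omega)]
    exact hx.elim (fun h => h.2 y hxy) (fun h => hup h.1)
  · rw [if_neg hxi] at hx
    split_ifs
    · exact Or.inr ⟨hup hx, x, hxy, hx⟩
    · exact hup hx

theorem isOF_applyOF (hcov : ∀ x y : P, x ⋖ y → rk y = rk x + 1) {F : Finset P}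
    (hF : IsOF F) (w : List ℕ) : IsOF (applyOF rk w F) := by
  induction w with
  | nil => exact hF
  | cons i w ih => exact isOF_rankToggleOF hcov ih i

theorem isOF_iterate_rowOF (hcov : ∀ x y : P, x ⋖ y → rk y = rk x + 1) {F : Finset P}
    (hF : IsOF F) (r k : ℕ) : IsOF ((RowOF rk r)^[k] F) := by
  induction k with
  | zero => exact hF
  | succ k ih =>
    rw [Function.iterate_succ_apply']
    exact isOF_applyOF hcov ih _

theorem applyOF_append (w v : List ℕ) (F : Finset P) :
    applyOF rk (w ++ v) F = applyOF rk w (applyOF rk v F) := by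
  induction w with
  | nil => rfl
  | cons i w ih => simp [applyOF, ih]

theorem mem_applyOF_of_rk_notMem {w : List ℕ} {F : Finset P} {p : P} (h : rk p ∉ w) :
    p ∈ applyOF rk w F ↔ p ∈ F := by
  induction w with
  | nil => rfl
  | cons i w ih =>
    rw [List.mem_cons, not_or] at h
    simp [applyOF, rankToggleOF, h.1, ih h.2]

/-- Toggles at ranks at least `k` only see the ranks at least `k - 1`. -/
theorem mem_applyOF_congr (hcov : ∀ x y : P, x ⋖ y → rk y = rk x + 1) {A B : Finset P}
    (hA : IsOF A) (hB : IsOF B) {k : ℕ} {w : List ℕ} (hw : ∀ j ∈ w, k ≤ j)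
    (hAB : ∀ p, k ≤ rk p + 1 → (p ∈ A ↔ p ∈ B)) (p : P) (hp : k ≤ rk p + 1) :
    p ∈ applyOF rk w A ↔ p ∈ applyOF rk w B := by
  induction w generalizing p with
  | nil => exact hAB p hp
  | cons i w ih =>
    have ih := ih fun j hj => hw j (List.mem_cons_of_mem i hj)
    have hi : k ≤ i := hw i List.mem_cons_self
    rw [applyOF, applyOF, mem_rankToggleOF_iff (isOF_applyOF hcov hA w),
      mem_rankToggleOF_iff (isOF_applyOF hcov hB w), ih p hp]
    by_cases hpi : rk p = i
    · have hup : ∀ q, p ⋖ q → (q ∈ applyOF rk w A ↔ q ∈ applyOF rk w B) := fun q hq =>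
        ih q (by have := hcov p q hq; omega)
      have hdown : ∀ q, q ⋖ p → (q ∈ applyOF rk w A ↔ q ∈ applyOF rk w B) := fun q hq =>
        ih q (by have := hcov q p hq; omega)
      rw [if_pos hpi, if_pos hpi, forall₂_congr hup,
        exists_congr fun q => and_congr_right (hdown q)]
    · rw [if_neg hpi, if_neg hpi]

theorem rk_le_of_graded {r : ℕ} (hcov : ∀ x y : P, x ⋖ y → rk y = rk x + 1)
    (hmax : ∀ x : P, IsMax x → rk x = r) (p : P) : rk p ≤ r := by
  obtain ⟨m, hpm, hm⟩ := Finite.exists_le_maximal (p := fun _ : P => True) (a := p) trivial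
  rw [← hmax m (maximal_true.1 hm)]
  let _ : LocallyFiniteOrder P := Fintype.toLocallyFiniteOrder
  have hmono : Monotone rk := (monotone_iff_forall_covBy rk).2 fun a b h => by
    rw [hcov a b h]; exact Nat.le_succ _
  exact hmono hpm

/-- After the first `k` factors of rowvacuation, ranks at least `k - 1` agree with the `k`-th
iterate of rowmotion and the ranks `j < k` agree with the `(j + 1)`-st one. -/
def RvacInvariant (rk : P → ℕ) (r : ℕ) (F : Finset P) (k : ℕ) (w : List ℕ) : Prop :=
  (∀ p, k ≤ rk p + 1 → (p ∈ applyOF rk w F ↔ p ∈ (RowOF rk r)^[k] F)) ∧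
    ∀ p, rk p < k → (p ∈ applyOF rk w F ↔ p ∈ (RowOF rk r)^[rk p + 1] F)

theorem RvacInvariant.drop_append (hcov : ∀ x y : P, x ⋖ y → rk y = rk x + 1) {F : Finset P}
    (hF : IsOF F) {r k : ℕ} {w : List ℕ} (h : RvacInvariant rk r F k w) :
    RvacInvariant rk r F (k + 1) ((List.range (r + 1)).drop k ++ w) := by
  have hdrop : ∀ j ∈ (List.range (r + 1)).drop k, k ≤ j := by
    intro j hj
    obtain ⟨n, hn, rfl⟩ := List.mem_iff_getElem.1 hj
    simp
  have htake : ∀ j ∈ (List.range (r + 1)).take k, j < k := by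
    intro j hj
    obtain ⟨n, hn, rfl⟩ := List.mem_iff_getElem.1 hj
    simp at hn ⊢
    omega
  have hge : ∀ p, k ≤ rk p → (p ∈ applyOF rk ((List.range (r + 1)).drop k ++ w) F ↔
      p ∈ (RowOF rk r)^[k + 1] F) := by
    intro p hp
    have hrow (G : Finset P) : RowOF rk r G = applyOF rk ((List.range (r + 1)).take k)
        (applyOF rk ((List.range (r + 1)).drop k) G) := by
      rw [← applyOF_append, List.take_append_drop, RowOF]
    rw [Function.iterate_succ_apply', hrow, applyOF_append,
      mem_applyOF_of_rk_notMem fun hmem => absurd (htake _ hmem) (by omega)]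
    exact mem_applyOF_congr hcov (isOF_applyOF hcov hF w) (isOF_iterate_rowOF hcov hF r k)
      hdrop h.1 p (by omega)
  refine ⟨fun p hp => hge p (by omega), fun p hp => ?_⟩
  rcases Nat.lt_succ_iff_lt_or_eq.1 hp with hlt | heq
  · rw [applyOF_append,
      mem_applyOF_of_rk_notMem fun hmem => absurd (hdrop _ hmem) (by omega), h.2 p hlt]
  · rw [heq]
    exact hge p heq.ge

theorem rvacInvariant_foldr (hcov : ∀ x y : P, x ⋖ y → rk y = rk x + 1) {F : Finset P}
    (hF : IsOF F) (r n : ℕ) (w : List ℕ) (hn : n ≤ r + 1)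
    (h : RvacInvariant rk r F (r + 1 - n) w) :
    RvacInvariant rk r F (r + 1)
      ((List.range n).foldr (fun k acc => (List.range (r + 1)).drop (r - k) ++ acc) w) := by
  induction n generalizing w with
  | zero => exact h
  | succ n ih =>
    rw [List.range_succ (n := n), List.foldr_append]
    refine ih _ (by omega) ?_
    have h' := h.drop_append hcov hF
    rwa [show r + 1 - (n + 1) + 1 = r + 1 - n by omega,
      show r + 1 - (n + 1) = r - n by omega] at h'

end

/-- Let `P` be a graded poset of rank `r`, let `F` be an order filter of
`P`, and let `p ∈ P` be an element of rank `i`.  Then `p ∈ Rvac_F F` if and only if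
`p ∈ Row_F^(i+1) F`. -/
theorem stmt19 {P : Type} [Fintype P] [PartialOrder P] [Nonempty P]
    (r : ℕ) (rk : P → ℕ)
    (hmin : ∀ x : P, IsMin x → rk x = 0)
    (hcov : ∀ x y : P, x ⋖ y → rk y = rk x + 1)
    (hmax : ∀ x : P, IsMax x → rk x = r)
    (F : Finset P) (hF : IsOF F)
    (p : P) (i : ℕ) (hp : rk p = i) :
    p ∈ RvacOF rk r F ↔ p ∈ (RowOF rk r)^[i + 1] F := by
  have hir : rk p ≤ r := rk_le_of_graded hcov hmax p
  have h := rvacInvariant_foldr hcov hF r (r + 1) [] le_rfl (by simp [RvacInvariant, applyOF])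
  subst hp
  exact h.2 p (by omega)
end
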